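/- Let V > 0 and suppose (r1, r2) ∈ C(V,T,P̄). Then there exist -D/2 ≤ x_I ≤ x_F ≤ D/2 and t_I, t_F ≥ 0 with t_I + (x_F − x_I)/V + t_F = T, a feasible power allocation, and a pair (r1', r2') with r1' ≥ r1 and r2' ≥ r2 that is achievable for the HFH trajectory determined by (x_I, x_F, t_I, t_F) with that power allocation. That is, for any finite speed and flight duration, the hover-fly-hover trajectory is optimal for the UAV-enabled two-user broadcast channel. -/

import Mathlib

open MeasureTheory

/-- Channel power gain (normalized by noise) from the UAV at horizontal position `x`
to ground user 1 located at `-D/2`. -/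
noncomputable def h1 (D H β0 x : ℝ) : ℝ := β0 / ((x + D / 2) ^ 2 + H ^ 2)

/-- Channel power gain from the UAV at horizontal position `x` to ground user 2
located at `D/2`. -/
noncomputable def h2 (D H β0 x : ℝ) : ℝ := β0 / ((x - D / 2) ^ 2 + H ^ 2)

/-- A feasible trajectory is a `V`-Lipschitz function on `[0, T]`. -/
def FeasibleTraj (V T : ℝ) (x : ℝ → ℝ) : Prop :=
  ∀ s ∈ Set.Icc (0 : ℝ) T, ∀ t ∈ Set.Icc (0 : ℝ) T, |x s - x t| ≤ V * |s - t|

/-- A feasible power allocation: measurable, nonnegative, total power at most `P`. -/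
def FeasiblePower (P T : ℝ) (p1 p2 : ℝ → ℝ) : Prop :=
  Measurable p1 ∧ Measurable p2 ∧
    ∀ t ∈ Set.Icc (0 : ℝ) T, 0 ≤ p1 t ∧ 0 ≤ p2 t ∧ p1 t + p2 t ≤ P

/-- The rate pair `(r1, r2)` is achievable for trajectory `x` and power allocation
`(p1, p2)`. -/
def Achievable (D H β0 T : ℝ) (x p1 p2 : ℝ → ℝ) (r1 r2 : ℝ) : Prop :=
  0 ≤ r1 ∧ 0 ≤ r2 ∧
    r1 ≤ (1 / T) * ∫ t in (0 : ℝ)..T, Real.logb 2 (1 + p1 t * h1 D H β0 (x t)) ∧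
    r2 ≤ (1 / T) * ∫ t in (0 : ℝ)..T, Real.logb 2 (1 + p2 t * h2 D H β0 (x t)) ∧
    r1 + r2 ≤ (1 / T) * ∫ t in (0 : ℝ)..T,
      Real.logb 2 (1 + p1 t * h1 D H β0 (x t) + p2 t * h2 D H β0 (x t))

/-- The capacity region `C(V, T, P)` of the UAV-enabled two-user broadcast channel. -/
def CapacityRegion (D H β0 P V T : ℝ) : Set (ℝ × ℝ) :=
  {r | ∃ x p1 p2, FeasibleTraj V T x ∧ FeasiblePower P T p1 p2 ∧
    Achievable D H β0 T x p1 p2 r.1 r.2}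

/-- The hover-fly-hover (HFH) trajectory: hover at `xI` during `[0, tI]`, fly at
speed `V` during `(tI, T - tF)`, hover at `xF` during `[T - tF, T]`. -/
noncomputable def hfh (V T xI xF tI tF : ℝ) : ℝ → ℝ := fun t =>
  if t ≤ tI then xI else if t < T - tF then xI + V * (t - tI) else xF

/-- Numerator of the stationary power. -/
noncomputable def powerNum (P w g g' : ℝ) : ℝ := (1 - 2 * w) * (1 + P * g') * g - w * (g' - g)

/-- Denominator of the stationary power. -/
noncomputable def powerDen (w g g' : ℝ) : ℝ := (1 - w) * (g' - g) * g

/-- Power of the user with gain `g` maximizing the weighted sum rate when that user has the larger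
weight `1 - w`, for `w ≤ 1 / 2`; the other user receives the rest of `P`. -/
noncomputable def priorityPower (P w g g' : ℝ) : ℝ :=
  P * (max (powerNum P w g g') 0 / max (P * powerDen w g g') (powerNum P w g g'))

section
variable {P w g g' : ℝ}

theorem priorityPower_denom_pos (hP : 0 < P) (hw0 : 0 ≤ w) (hw : w ≤ 1 / 2) (hg : 0 < g)
    (hg' : 0 < g') (h : w ≠ 1 / 2 ∨ g ≠ g') :
    0 < max (P * powerDen w g g') (powerNum P w g g') := by
  rcases lt_or_ge g g' with hlt | hge
  · refine lt_max_of_lt_left ?_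
    have h1 : 0 < 1 - w := by linarith
    have h2 : 0 < g' - g := by linarith
    unfold powerDen
    positivity
  · refine lt_max_of_lt_right ?_
    have hA : 0 < (1 + P * g') * g := by positivity
    unfold powerNum
    rcases hw.lt_or_eq with hw' | rfl
    · have := mul_pos (by linarith : 0 < 1 - 2 * w) hA
      nlinarith [mul_nonneg hw0 (sub_nonneg.2 hge)]
    · have : g' < g := lt_of_le_of_ne hge fun e => by simp [e] at h
      linarith

theorem priorityPower_denom_nonneg (hP : 0 < P) (hw0 : 0 ≤ w) (hw : w ≤ 1 / 2) (hg : 0 < g)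
    (hg' : 0 < g') : 0 ≤ max (P * powerDen w g g') (powerNum P w g g') := by
  by_cases h : w ≠ 1 / 2 ∨ g ≠ g'
  · exact (priorityPower_denom_pos hP hw0 hw hg hg' h).le
  · push Not at h
    simp [powerDen, h.2]

theorem priorityPower_mem_Icc (hP : 0 < P) (hw0 : 0 ≤ w) (hw : w ≤ 1 / 2) (hg : 0 < g)
    (hg' : 0 < g') : priorityPower P w g g' ∈ Set.Icc 0 P := by
  have hd := priorityPower_denom_nonneg hP hw0 hw hg hg'
  refine ⟨mul_nonneg hP.le (div_nonneg (le_max_right _ _) hd), mul_le_of_le_one_right hP.le ?_⟩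
  exact div_le_one_of_le₀ (max_le (le_max_right _ _) hd) hd

theorem priorityPower_variational (hP : 0 < P) (hw0 : 0 ≤ w) (hw : w ≤ 1 / 2) (hg : 0 < g)
    (hg' : 0 < g') {v : ℝ} (hv : v ∈ Set.Icc 0 P) :
    (v - priorityPower P w g g') *
      (powerNum P w g g' - priorityPower P w g g' * powerDen w g g') ≤ 0 := by
  by_cases h : w ≠ 1 / 2 ∨ g ≠ g'
  · have hd := priorityPower_denom_pos hP hw0 hw hg hg' h
    unfold priorityPower
    generalize powerNum P w g g' = N at *
    generalize powerDen w g g' = d at *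
    rcases le_total (P * d) N with hle | hle
    · rw [max_eq_right hle] at hd ⊢
      rw [max_eq_left hd.le, div_self hd.ne', mul_one]
      exact mul_nonpos_of_nonpos_of_nonneg (by linarith [hv.2]) (by linarith)
    · rw [max_eq_left hle] at hd ⊢
      have hd0 : 0 < d := pos_of_mul_pos_right hd hP.le
      rcases le_total N 0 with hN | hN
      · rw [max_eq_right hN]
        simpa using mul_nonpos_of_nonneg_of_nonpos hv.1 hN
      · rw [max_eq_left hN]
        have : N - P * (N / (P * d)) * d = 0 := by field_simp; ring
        rw [this, mul_zero]
  · push Not at h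
    obtain ⟨rfl, rfl⟩ := h
    simp [powerNum, powerDen]

theorem weighted_log_le_priorityPower (hP : 0 < P) (hw0 : 0 ≤ w) (hw : w ≤ 1 / 2) (hg : 0 < g)
    (hg' : 0 < g') {v v' : ℝ} (hv : 0 ≤ v) (hv' : 0 ≤ v') (hvP : v + v' ≤ P) :
    (1 - 2 * w) * Real.log (1 + v * g) + w * Real.log (1 + v * g + v' * g') ≤
      (1 - 2 * w) * Real.log (1 + priorityPower P w g g' * g) +
        w * Real.log (1 + priorityPower P w g g' * g + (P - priorityPower P w g g') * g') := by
  have hu := priorityPower_mem_Icc hP hw0 hw hg hg'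
  have key := priorityPower_variational hP hw0 hw hg hg' (v := v) ⟨hv, by linarith⟩
  set u := priorityPower P w g g'
  have log_le : ∀ {y z : ℝ}, 0 < y → 0 < z → Real.log y ≤ Real.log z + (y - z) / z := by
    intro y z hy hz
    have := Real.log_le_sub_one_of_pos (div_pos hy hz)
    rw [Real.log_div hy.ne' hz.ne'] at this
    have e : (y - z) / z = y / z - 1 := by field_simp
    linarith
  have hA : 0 < 1 + u * g := by have := mul_nonneg hu.1 hg.le; linarith
  have hAv : 0 < 1 + v * g := by positivity
  have hB : 0 < 1 + u * g + (P - u) * g' := by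
    have := mul_nonneg (sub_nonneg.2 hu.2) hg'.le; linarith
  have hBv : 0 < 1 + v * g + (P - v) * g' := by
    have := mul_nonneg (by linarith : 0 ≤ P - v) hg'.le; linarith
  have e1 := log_le hAv hA
  have e2 := log_le hBv hB
  have e3 : Real.log (1 + v * g + v' * g') ≤ Real.log (1 + v * g + (P - v) * g') := by
    refine Real.log_le_log (by positivity) ?_
    have := mul_le_mul_of_nonneg_right (by linarith : v' ≤ P - v) hg'.le
    linarith
  have e4 : (1 - 2 * w) * ((1 + v * g - (1 + u * g)) / (1 + u * g)) +
      w * ((1 + v * g + (P - v) * g' - (1 + u * g + (P - u) * g')) /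
        (1 + u * g + (P - u) * g')) =
      (v - u) * (powerNum P w g g' - u * powerDen w g g') /
        ((1 + u * g) * (1 + u * g + (P - u) * g')) := by
    rw [mul_div_assoc', mul_div_assoc', div_add_div _ _ hA.ne' hB.ne']
    congr 1
    unfold powerNum powerDen
    ring
  have e5 : (v - u) * (powerNum P w g g' - u * powerDen w g g') /
        ((1 + u * g) * (1 + u * g + (P - u) * g')) ≤ 0 :=
    div_nonpos_of_nonpos_of_nonneg key (by positivity)
  have m1 := mul_le_mul_of_nonneg_left e1 (by linarith : 0 ≤ 1 - 2 * w)
  have m2 := mul_le_mul_of_nonneg_left (e3.trans e2) hw0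
  linarith

theorem priorityPower_half_of_lt (h : g < g') :
    priorityPower P (1 / 2) g g' = 0 := by
  have : max (powerNum P (1 / 2) g g') 0 = 0 := max_eq_right (by unfold powerNum; linarith)
  simp only [priorityPower, this, zero_div, mul_zero]

theorem priorityPower_half_of_gt (hP : 0 < P) (hg : 0 < g) (h : g' < g) :
    priorityPower P (1 / 2) g g' = P := by
  have hN : 0 < powerNum P (1 / 2) g g' := by unfold powerNum; linarith
  have hD : P * powerDen (1 / 2) g g' ≤ powerNum P (1 / 2) g g' := by
    refine le_trans ?_ hN.le
    unfold powerDen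
    exact mul_nonpos_of_nonneg_of_nonpos hP.le (mul_nonpos_of_nonpos_of_nonneg (by linarith) hg.le)
  rw [priorityPower, max_eq_left hN.le, max_eq_right hD, div_self hN.ne', mul_one]

end

theorem continuousAt_priorityPower {P : ℝ} (hP : 0 < P) {z : ℝ × ℝ × ℝ} (hw0 : 0 ≤ z.1)
    (hw : z.1 ≤ 1 / 2) (hg : 0 < z.2.1) (hg' : 0 < z.2.2) (h : z.1 ≠ 1 / 2 ∨ z.2.1 ≠ z.2.2) :
    ContinuousAt (fun z : ℝ × ℝ × ℝ => priorityPower P z.1 z.2.1 z.2.2) z := by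
  have hd := priorityPower_denom_pos hP hw0 hw hg hg' h
  unfold priorityPower
  refine continuousAt_const.mul (ContinuousAt.div ?_ ?_ hd.ne') <;>
    unfold powerNum <;> try unfold powerDen
  all_goals fun_prop

/-- Rate of user 1 under the optimal superposition coding for the weights `(1 - w, w)`. -/
noncomputable def optRate₁ (P w g₁ g₂ : ℝ) : ℝ :=
  if w ≤ 1 / 2 then Real.log (1 + priorityPower P w g₁ g₂ * g₁)
  else Real.log (1 + priorityPower P (1 - w) g₂ g₁ * g₂ +
    (P - priorityPower P (1 - w) g₂ g₁) * g₁) - Real.log (1 + priorityPower P (1 - w) g₂ g₁ * g₂)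

/-- Rate of user 2 under the optimal superposition coding for the weights `(1 - w, w)`. -/
noncomputable def optRate₂ (P w g₁ g₂ : ℝ) : ℝ :=
  if w ≤ 1 / 2 then Real.log (1 + priorityPower P w g₁ g₂ * g₁ +
    (P - priorityPower P w g₁ g₂) * g₂) - Real.log (1 + priorityPower P w g₁ g₂ * g₁)
  else Real.log (1 + priorityPower P (1 - w) g₂ g₁ * g₂)

/-- Power of user 1 maximizing the weighted sum rate for the weights `(1 - w, w)`. -/
noncomputable def optPower (P w g₁ g₂ : ℝ) : ℝ :=
  if w ≤ 1 / 2 then priorityPower P w g₁ g₂ else P - priorityPower P (1 - w) g₂ g₁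

/-- Largest value of `(1 - w) * r₁ + w * r₂` over the rate pairs `(r₁, r₂)` supported by the
powers `(p₁, p₂)`. -/
noncomputable def weightedRate (w g₁ g₂ p₁ p₂ : ℝ) : ℝ :=
  min w (1 - w) * Real.log (1 + p₁ * g₁ + p₂ * g₂) +
    max (1 - 2 * w) 0 * Real.log (1 + p₁ * g₁) + max (2 * w - 1) 0 * Real.log (1 + p₂ * g₂)

theorem weightedRate_of_le {w : ℝ} (hw : w ≤ 1 / 2) (g₁ g₂ p₁ p₂ : ℝ) :
    weightedRate w g₁ g₂ p₁ p₂ =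
      (1 - 2 * w) * Real.log (1 + p₁ * g₁) + w * Real.log (1 + p₁ * g₁ + p₂ * g₂) := by
  rw [weightedRate, min_eq_left (by linarith), max_eq_left (by linarith),
    max_eq_right (by linarith)]
  ring

theorem weightedRate_of_ge {w : ℝ} (hw : 1 / 2 ≤ w) (g₁ g₂ p₁ p₂ : ℝ) :
    weightedRate w g₁ g₂ p₁ p₂ =
      (2 * w - 1) * Real.log (1 + p₂ * g₂) +
        (1 - w) * Real.log (1 + p₁ * g₁ + p₂ * g₂) := by
  rw [weightedRate, min_eq_right (by linarith), max_eq_right (by linarith),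
    max_eq_left (by linarith)]
  ring

theorem log_one_add_add_le {a b : ℝ} (ha : 0 ≤ a) (hb : 0 ≤ b) :
    Real.log (1 + a + b) ≤ Real.log (1 + a) + Real.log (1 + b) := by
  rw [← Real.log_mul (by positivity) (by positivity)]
  refine Real.log_le_log (by positivity) ?_
  nlinarith [mul_nonneg ha hb]

section
variable {P w g₁ g₂ : ℝ}

theorem optPower_mem_Icc (hP : 0 < P) (hw : w ∈ Set.Icc (0 : ℝ) 1) (hg₁ : 0 < g₁)
    (hg₂ : 0 < g₂) : optPower P w g₁ g₂ ∈ Set.Icc 0 P := by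
  unfold optPower
  split_ifs with h
  · exact priorityPower_mem_Icc hP hw.1 h hg₁ hg₂
  · have := priorityPower_mem_Icc (w := 1 - w) hP (by linarith [hw.2]) (by linarith) hg₂ hg₁
    exact ⟨by linarith [this.2], by linarith [this.1]⟩

theorem optRate_add (P w g₁ g₂ : ℝ) :
    optRate₁ P w g₁ g₂ + optRate₂ P w g₁ g₂ =
      Real.log (1 + optPower P w g₁ g₂ * g₁ + (P - optPower P w g₁ g₂) * g₂) := by
  unfold optPower optRate₁ optRate₂
  split_ifs with h
  · ring
  · rw [sub_add_cancel]
    ring_nf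

theorem optRate₁_le (hP : 0 < P) (hw : w ∈ Set.Icc (0 : ℝ) 1) (hg₁ : 0 < g₁) (hg₂ : 0 < g₂) :
    optRate₁ P w g₁ g₂ ≤ Real.log (1 + optPower P w g₁ g₂ * g₁) := by
  unfold optPower optRate₁
  split_ifs with h
  · exact le_rfl
  · have := priorityPower_mem_Icc (w := 1 - w) hP (by linarith [hw.2]) (by linarith) hg₂ hg₁
    have := log_one_add_add_le (mul_nonneg this.1 hg₂.le)
      (mul_nonneg (sub_nonneg.2 this.2) hg₁.le)
    linarith

theorem optRate₂_le (hP : 0 < P) (hw : w ∈ Set.Icc (0 : ℝ) 1) (hg₁ : 0 < g₁) (hg₂ : 0 < g₂) :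
    optRate₂ P w g₁ g₂ ≤ Real.log (1 + (P - optPower P w g₁ g₂) * g₂) := by
  unfold optPower optRate₂
  split_ifs with h
  · have := priorityPower_mem_Icc hP hw.1 h hg₁ hg₂
    have := log_one_add_add_le (mul_nonneg this.1 hg₁.le)
      (mul_nonneg (sub_nonneg.2 this.2) hg₂.le)
    linarith
  · rw [sub_sub_cancel]

theorem optRate₁_nonneg (hP : 0 < P) (hw : w ∈ Set.Icc (0 : ℝ) 1) (hg₁ : 0 < g₁)
    (hg₂ : 0 < g₂) : 0 ≤ optRate₁ P w g₁ g₂ := by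
  unfold optRate₁
  split_ifs with h
  · have := priorityPower_mem_Icc hP hw.1 h hg₁ hg₂
    exact Real.log_nonneg (by linarith [mul_nonneg this.1 hg₁.le])
  · have := priorityPower_mem_Icc (w := 1 - w) hP (by linarith [hw.2]) (by linarith) hg₂ hg₁
    refine sub_nonneg.2 (Real.log_le_log (by linarith [mul_nonneg this.1 hg₂.le]) ?_)
    linarith [mul_nonneg (sub_nonneg.2 this.2) hg₁.le]

theorem optRate₂_nonneg (hP : 0 < P) (hw : w ∈ Set.Icc (0 : ℝ) 1) (hg₁ : 0 < g₁)
    (hg₂ : 0 < g₂) : 0 ≤ optRate₂ P w g₁ g₂ := by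
  unfold optRate₂
  split_ifs with h
  · have := priorityPower_mem_Icc hP hw.1 h hg₁ hg₂
    refine sub_nonneg.2 (Real.log_le_log (by linarith [mul_nonneg this.1 hg₁.le]) ?_)
    linarith [mul_nonneg (sub_nonneg.2 this.2) hg₂.le]
  · have := priorityPower_mem_Icc (w := 1 - w) hP (by linarith [hw.2]) (by linarith) hg₂ hg₁
    exact Real.log_nonneg (by linarith [mul_nonneg this.1 hg₂.le])

theorem weightedRate_optPower (P w g₁ g₂ : ℝ) :
    weightedRate w g₁ g₂ (optPower P w g₁ g₂) (P - optPower P w g₁ g₂) =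
      (1 - w) * optRate₁ P w g₁ g₂ + w * optRate₂ P w g₁ g₂ := by
  unfold optPower optRate₁ optRate₂
  split_ifs with h
  · rw [weightedRate_of_le h]
    ring
  · rw [weightedRate_of_ge (by linarith), sub_sub_cancel,
      add_right_comm 1 ((P - priorityPower P (1 - w) g₂ g₁) * g₁)]
    ring

theorem weightedRate_le_optRate (hP : 0 < P) (hw : w ∈ Set.Icc (0 : ℝ) 1) (hg₁ : 0 < g₁)
    (hg₂ : 0 < g₂) {p₁ p₂ : ℝ} (hp₁ : 0 ≤ p₁) (hp₂ : 0 ≤ p₂) (hp : p₁ + p₂ ≤ P) :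
    weightedRate w g₁ g₂ p₁ p₂ ≤ (1 - w) * optRate₁ P w g₁ g₂ + w * optRate₂ P w g₁ g₂ := by
  rw [← weightedRate_optPower, optPower]
  split_ifs with h
  · rw [weightedRate_of_le h, weightedRate_of_le h]
    exact weighted_log_le_priorityPower hP hw.1 h hg₁ hg₂ hp₁ hp₂ hp
  · have := weighted_log_le_priorityPower (w := 1 - w) hP (by linarith [hw.2]) (by linarith)
      hg₂ hg₁ hp₂ hp₁ (by linarith)
    rw [weightedRate_of_ge (by linarith), weightedRate_of_ge (by linarith), sub_sub_cancel,
      add_right_comm 1 (p₁ * g₁),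
      add_right_comm 1 ((P - priorityPower P (1 - w) g₂ g₁) * g₁)]
    convert this using 3 <;> ring

theorem optRate₁_le_const (hP : 0 < P) (hw : w ∈ Set.Icc (0 : ℝ) 1) (hg₁ : 0 < g₁)
    (hg₂ : 0 < g₂) {G : ℝ} (hG : g₁ ≤ G) : optRate₁ P w g₁ g₂ ≤ Real.log (1 + P * G) := by
  have hu := optPower_mem_Icc hP hw hg₁ hg₂
  refine (optRate₁_le hP hw hg₁ hg₂).trans (Real.log_le_log ?_ ?_)
  · linarith [mul_nonneg hu.1 hg₁.le]
  · linarith [mul_le_mul hu.2 hG hg₁.le hP.le]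

theorem optRate₂_le_const (hP : 0 < P) (hw : w ∈ Set.Icc (0 : ℝ) 1) (hg₁ : 0 < g₁)
    (hg₂ : 0 < g₂) {G : ℝ} (hG : g₂ ≤ G) : optRate₂ P w g₁ g₂ ≤ Real.log (1 + P * G) := by
  have hu := optPower_mem_Icc hP hw hg₁ hg₂
  have h1 : P - optPower P w g₁ g₂ ≤ P := by linarith [hu.1]
  refine (optRate₂_le hP hw hg₁ hg₂).trans (Real.log_le_log ?_ ?_)
  · linarith [mul_nonneg (sub_nonneg.2 hu.2) hg₂.le]
  · linarith [mul_le_mul h1 hG hg₂.le hP.le]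

end

theorem continuousAt_ite_le_half {X : Type*} [TopologicalSpace X] {c f g : X → ℝ} {x : X}
    (hc : ContinuousAt c x) (hf : c x ≤ 1 / 2 → ContinuousAt f x)
    (hg : 1 / 2 ≤ c x → ContinuousAt g x) (hfg : c x = 1 / 2 → f x = g x) :
    ContinuousAt (fun y => if c y ≤ 1 / 2 then f y else g y) x := by
  rcases lt_trichotomy (c x) (1 / 2) with h | h | h
  · refine (hf h.le).congr ?_
    filter_upwards [hc.eventually_lt_const h] with y hy
    rw [if_pos hy.le]
  · have h1 := hf h.le
    have h2 := hg h.ge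
    unfold ContinuousAt at h1 h2
    rw [← hfg h] at h2
    simpa only [ContinuousAt, if_pos h.le] using h1.if' h2
  · refine (hg h.le).congr ?_
    filter_upwards [hc.eventually_const_lt h] with y hy
    rw [if_neg hy.not_ge]

section
variable {P : ℝ} {z : ℝ × ℝ × ℝ}

theorem continuousAt_priorityPower_swap (hP : 0 < P) (hw : z.1 ≤ 1) (hw' : 1 / 2 ≤ z.1)
    (hg₁ : 0 < z.2.1) (hg₂ : 0 < z.2.2) (h : z.1 ≠ 1 / 2 ∨ z.2.1 ≠ z.2.2) :
    ContinuousAt (fun z : ℝ × ℝ × ℝ => priorityPower P (1 - z.1) z.2.2 z.2.1) z := by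
  refine ContinuousAt.comp (f := fun z : ℝ × ℝ × ℝ => (1 - z.1, z.2.2, z.2.1))
    (g := fun z : ℝ × ℝ × ℝ => priorityPower P z.1 z.2.1 z.2.2)
    (continuousAt_priorityPower hP (by simpa using hw) ?_ hg₂ hg₁ ?_) (by fun_prop)
  · show 1 - z.1 ≤ 1 / 2
    linarith
  · refine h.imp (fun h h' => h ?_) Ne.symm
    have : 1 - z.1 = 1 / 2 := h'
    linarith

theorem continuousAt_optRate₁ (hP : 0 < P) (hw : z.1 ∈ Set.Icc (0 : ℝ) 1) (hg₁ : 0 < z.2.1)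
    (hg₂ : 0 < z.2.2) (h : z.1 ≠ 1 / 2 ∨ z.2.1 ≠ z.2.2) :
    ContinuousAt (fun z : ℝ × ℝ × ℝ => optRate₁ P z.1 z.2.1 z.2.2) z := by
  refine continuousAt_ite_le_half (by fun_prop) (fun hz => ?_) (fun hz => ?_) (fun hz => ?_)
  · have hu := priorityPower_mem_Icc hP hw.1 hz hg₁ hg₂
    have := continuousAt_priorityPower hP hw.1 hz hg₁ hg₂ h
    exact ContinuousAt.log (by fun_prop) (by linarith [mul_nonneg hu.1 hg₁.le])
  · have hu := priorityPower_mem_Icc (w := 1 - z.1) hP (by linarith [hw.2]) (by linarith) hg₂ hg₁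
    have := continuousAt_priorityPower_swap hP hw.2 hz hg₁ hg₂ h
    have h1 := mul_nonneg hu.1 hg₂.le
    have h2 := mul_nonneg (sub_nonneg.2 hu.2) hg₁.le
    refine ContinuousAt.sub (ContinuousAt.log (by fun_prop) ?_)
      (ContinuousAt.log (by fun_prop) ?_)
    · linarith
    · linarith
  · have e : 1 - z.1 = 1 / 2 := by linarith
    rw [e, hz]
    rcases lt_or_gt_of_ne (h.resolve_left (not_not.2 hz)) with hlt | hlt
    · rw [priorityPower_half_of_lt hlt, priorityPower_half_of_gt hP hg₂ hlt]
      simp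
    · rw [priorityPower_half_of_gt hP hg₁ hlt, priorityPower_half_of_lt hlt]
      simp

theorem continuousAt_optRate₂ (hP : 0 < P) (hw : z.1 ∈ Set.Icc (0 : ℝ) 1) (hg₁ : 0 < z.2.1)
    (hg₂ : 0 < z.2.2) (h : z.1 ≠ 1 / 2 ∨ z.2.1 ≠ z.2.2) :
    ContinuousAt (fun z : ℝ × ℝ × ℝ => optRate₂ P z.1 z.2.1 z.2.2) z := by
  refine continuousAt_ite_le_half (by fun_prop) (fun hz => ?_) (fun hz => ?_) (fun hz => ?_)
  · have hu := priorityPower_mem_Icc hP hw.1 hz hg₁ hg₂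
    have := continuousAt_priorityPower hP hw.1 hz hg₁ hg₂ h
    have h1 := mul_nonneg hu.1 hg₁.le
    have h2 := mul_nonneg (sub_nonneg.2 hu.2) hg₂.le
    refine ContinuousAt.sub (ContinuousAt.log (by fun_prop) ?_)
      (ContinuousAt.log (by fun_prop) ?_)
    · linarith
    · linarith
  · have hu := priorityPower_mem_Icc (w := 1 - z.1) hP (by linarith [hw.2]) (by linarith) hg₂ hg₁
    have := continuousAt_priorityPower_swap hP hw.2 hz hg₁ hg₂ h
    exact ContinuousAt.log (by fun_prop) (by linarith [mul_nonneg hu.1 hg₂.le])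
  · have e : 1 - z.1 = 1 / 2 := by linarith
    rw [e, hz]
    rcases lt_or_gt_of_ne (h.resolve_left (not_not.2 hz)) with hlt | hlt
    · rw [priorityPower_half_of_lt hlt, priorityPower_half_of_gt hP hg₂ hlt]
      simp
    · rw [priorityPower_half_of_gt hP hg₁ hlt, priorityPower_half_of_lt hlt]
      simp

end

theorem measurable_optRate₁ {g₁ g₂ : ℝ → ℝ} (P w : ℝ) (h₁ : Measurable g₁)
    (h₂ : Measurable g₂) : Measurable fun x => optRate₁ P w (g₁ x) (g₂ x) := by
  unfold optRate₁ priorityPower powerNum powerDen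
  split_ifs <;> fun_prop

theorem measurable_optRate₂ {g₁ g₂ : ℝ → ℝ} (P w : ℝ) (h₁ : Measurable g₁)
    (h₂ : Measurable g₂) : Measurable fun x => optRate₂ P w (g₁ x) (g₂ x) := by
  unfold optRate₂ priorityPower powerNum powerDen
  split_ifs <;> fun_prop

theorem measurable_optPower {g₁ g₂ : ℝ → ℝ} (P w : ℝ) (h₁ : Measurable g₁)
    (h₂ : Measurable g₂) : Measurable fun x => optPower P w (g₁ x) (g₂ x) := by
  unfold optPower priorityPower powerNum powerDen
  split_ifs <;> fun_prop

/-- The maximal weighted sum rate depends continuously on the weight and on the position. -/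
theorem continuousOn_weighted_optRate {P : ℝ} (hP : 0 < P) {g₁ g₂ : ℝ → ℝ} (hc₁ : Continuous g₁)
    (hc₂ : Continuous g₂) (hg₁ : ∀ x, 0 < g₁ x) (hg₂ : ∀ x, 0 < g₂ x) :
    ContinuousOn (fun z : ℝ × ℝ => (1 - z.1) * optRate₁ P z.1 (g₁ z.2) (g₂ z.2) +
      z.1 * optRate₂ P z.1 (g₁ z.2) (g₂ z.2)) (Set.Icc 0 1 ×ˢ Set.univ) := by
  have hne : (Set.univ : Set (Set.Icc (0 : ℝ) P)).Nonempty := ⟨⟨0, le_rfl, hP.le⟩, trivial⟩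
  have hf : Continuous ↿fun (z : ℝ × ℝ) (u : Set.Icc (0 : ℝ) P) =>
      weightedRate z.1 (g₁ z.2) (g₂ z.2) u (P - u) := by
    unfold weightedRate Function.HasUncurry.uncurry Function.hasUncurryInduction
      Function.hasUncurryBase
    simp only [id]
    have p1 : ∀ q : (ℝ × ℝ) × Set.Icc (0 : ℝ) P, 0 ≤ (q.2 : ℝ) * g₁ q.1.2 := fun q =>
      mul_nonneg q.2.2.1 (hg₁ _).le
    have p2 : ∀ q : (ℝ × ℝ) × Set.Icc (0 : ℝ) P, 0 ≤ (P - q.2) * g₂ q.1.2 := fun q =>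
      mul_nonneg (sub_nonneg.2 q.2.2.2) (hg₂ _).le
    refine ((Continuous.mul (by fun_prop) (Continuous.log (by fun_prop) fun q => ?_)).add
      (Continuous.mul (by fun_prop) (Continuous.log (by fun_prop) fun q => ?_))).add
      (Continuous.mul (by fun_prop) (Continuous.log (by fun_prop) fun q => ?_))
    · linarith [p1 q, p2 q]
    · linarith [p1 q]
    · linarith [p2 q]
  refine (isCompact_univ.continuous_sSup hf).continuousOn.congr fun z hz => ?_
  refine (IsGreatest.csSup_eq ⟨?_, ?_⟩).symm
  · exact ⟨⟨optPower P z.1 (g₁ z.2) (g₂ z.2), optPower_mem_Icc hP hz.1 (hg₁ _) (hg₂ _)⟩, trivial,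
      weightedRate_optPower ..⟩
  · rintro _ ⟨u, -, rfl⟩
    exact weightedRate_le_optRate hP hz.1 (hg₁ _) (hg₂ _) u.2.1 (sub_nonneg.2 u.2.2) (by linarith)

/-- A compact set is preconnected if its image and its fibers under a continuous map are. -/
theorem IsCompact.isPreconnected_of_fibers {X Y : Type*} [TopologicalSpace X] [TopologicalSpace Y]
    [T2Space Y] {S : Set X} {f : X → Y} (hS : IsCompact S) (hf : Continuous f)
    (hfib : ∀ y, IsPreconnected (S ∩ f ⁻¹' {y})) (him : IsPreconnected (f '' S)) :
    IsPreconnected S := by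
  rw [isPreconnected_closed_iff] at him ⊢
  intro t t' ht ht' hcov ⟨p, hpS, hpt⟩ ⟨q, hqS, hqt⟩
  obtain ⟨y, -, ⟨u, ⟨huS, hut⟩, rfl⟩, v, ⟨hvS, hvt⟩, hv⟩ := him (f '' (S ∩ t)) (f '' (S ∩ t'))
    ((hS.inter_right ht).image hf).isClosed ((hS.inter_right ht').image hf).isClosed
    (by
      rintro _ ⟨z, hz, rfl⟩
      exact (hcov hz).imp (fun h => ⟨z, ⟨hz, h⟩, rfl⟩) fun h => ⟨z, ⟨hz, h⟩, rfl⟩)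
    ⟨f p, ⟨p, hpS, rfl⟩, ⟨p, ⟨hpS, hpt⟩, rfl⟩⟩ ⟨f q, ⟨q, hqS, rfl⟩, ⟨q, ⟨hqS, hqt⟩, rfl⟩⟩
  obtain ⟨z, ⟨hzS, -⟩, hz⟩ := isPreconnected_closed_iff.1 (hfib (f u)) t t' ht ht'
    (Set.inter_subset_left.trans hcov) ⟨u, ⟨huS, rfl⟩, hut⟩ ⟨v, ⟨hvS, hv⟩, hvt⟩
  exact ⟨z, hzS, hz⟩

/-- Hover-fly-hover parameters `(a, b, s)` with `a₀ ≤ a ≤ b ≤ b₀`, where a fraction `s` of the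
hovering time is spent at `b` and the rest at `a`, such that all the hovering takes place at
maximizers of `φ` on `[a₀, b₀]`. -/
def hoverSet (φ : ℝ → ℝ) (a₀ b₀ : ℝ) : Set (ℝ × ℝ × ℝ) :=
  {θ | a₀ ≤ θ.1 ∧ θ.1 ≤ θ.2.1 ∧ θ.2.1 ≤ b₀ ∧ θ.2.2 ∈ Set.Icc (0 : ℝ) 1 ∧
    ∀ y ∈ Set.Icc a₀ b₀, (1 - θ.2.2) * (φ y - φ θ.1) ≤ 0 ∧ θ.2.2 * (φ y - φ θ.2.1) ≤ 0}

theorem joinedIn_of_forall_mem_Icc {X : Type*} [TopologicalSpace X] {S : Set X} {g : ℝ → X}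
    (hg : Continuous g) {c d : ℝ} (hcd : c ≤ d) (h : ∀ t ∈ Set.Icc c d, g t ∈ S) :
    JoinedIn S (g c) (g d) := by
  have := ((convex_Icc c d).isPathConnected ⟨c, le_rfl, hcd⟩).image hg
  exact (this.joinedIn _ ⟨c, ⟨le_rfl, hcd⟩, rfl⟩ _ ⟨d, ⟨hcd, le_rfl⟩, rfl⟩).mono
    (by rintro _ ⟨t, ht, rfl⟩; exact h t ht)

section
variable {φ : ℝ → ℝ} {a₀ b₀ : ℝ}

theorem hover_mem_hoverSet {c s : ℝ} (hc : c ∈ Set.Icc a₀ b₀) (hmax : IsMaxOn φ (Set.Icc a₀ b₀) c)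
    (hs : s ∈ Set.Icc (0 : ℝ) 1) : (c, c, s) ∈ hoverSet φ a₀ b₀ := by
  refine ⟨hc.1, le_rfl, hc.2, hs, fun y hy => ?_⟩
  have := isMaxOn_iff.1 hmax y hy
  exact ⟨mul_nonpos_of_nonneg_of_nonpos (sub_nonneg.2 hs.2) (sub_nonpos.2 this),
    mul_nonpos_of_nonneg_of_nonpos hs.1 (sub_nonpos.2 this)⟩

theorem joinedIn_hoverSet_of_isMaxOn {c c' : ℝ} (hc : c ∈ Set.Icc a₀ b₀)
    (hmax : IsMaxOn φ (Set.Icc a₀ b₀) c) (hc' : c' ∈ Set.Icc a₀ b₀)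
    (hmax' : IsMaxOn φ (Set.Icc a₀ b₀) c') (h : c ≤ c') :
    JoinedIn (hoverSet φ a₀ b₀) (c, c, 0) (c', c', 0) := by
  rw [isMaxOn_iff] at hmax hmax'
  have s1 : JoinedIn (hoverSet φ a₀ b₀) (c, c, 0) (c, c', 0) :=
    joinedIn_of_forall_mem_Icc (g := fun t => (c, t, 0)) (by fun_prop) h fun t ht =>
      ⟨hc.1, ht.1, ht.2.trans hc'.2, by simp, fun y hy => by simpa using hmax y hy⟩
  have s2 : JoinedIn (hoverSet φ a₀ b₀) (c, c', 0) (c, c', 1) :=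
    joinedIn_of_forall_mem_Icc (g := fun t => (c, c', t)) (by fun_prop) zero_le_one fun t ht =>
      ⟨hc.1, h, hc'.2, ht, fun y hy =>
        ⟨mul_nonpos_of_nonneg_of_nonpos (sub_nonneg.2 ht.2) (sub_nonpos.2 (hmax y hy)),
          mul_nonpos_of_nonneg_of_nonpos ht.1 (sub_nonpos.2 (hmax' y hy))⟩⟩
  have s3 : JoinedIn (hoverSet φ a₀ b₀) (c, c', 1) (c', c', 1) :=
    joinedIn_of_forall_mem_Icc (g := fun t => (t, c', 1)) (by fun_prop) h fun t ht =>
      ⟨hc.1.trans ht.1, ht.2, hc'.2, by simp, fun y hy => by simpa using hmax' y hy⟩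
  have s4 : JoinedIn (hoverSet φ a₀ b₀) (c', c', 0) (c', c', 1) :=
    joinedIn_of_forall_mem_Icc (g := fun t => (c', c', t)) (by fun_prop) zero_le_one fun t ht =>
      hover_mem_hoverSet hc' hmax' ht
  exact ((s1.trans s2).trans s3).trans s4.symm

theorem exists_joinedIn_hover {θ : ℝ × ℝ × ℝ} (hθ : θ ∈ hoverSet φ a₀ b₀) :
    ∃ c ∈ Set.Icc a₀ b₀, IsMaxOn φ (Set.Icc a₀ b₀) c ∧
      JoinedIn (hoverSet φ a₀ b₀) θ (c, c, 0) := by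
  obtain ⟨a, b, s⟩ := θ
  obtain ⟨ha, hab, hb, ⟨hs0, hs1⟩, hmax⟩ := hθ
  dsimp only at *
  rcases hs1.lt_or_eq with hs | rfl
  · have hamax : ∀ y ∈ Set.Icc a₀ b₀, φ y - φ a ≤ 0 := fun y hy =>
      nonpos_of_mul_nonpos_right (hmax y hy).1 (sub_pos.2 hs)
    have s1 : JoinedIn (hoverSet φ a₀ b₀) (a, b, 0) (a, b, s) :=
      joinedIn_of_forall_mem_Icc (g := fun t => (a, b, t)) (by fun_prop) hs0 fun t ht =>
        ⟨ha, hab, hb, ⟨ht.1, ht.2.trans hs1⟩, fun y hy =>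
          ⟨mul_nonpos_of_nonneg_of_nonpos (sub_nonneg.2 (ht.2.trans hs1)) (hamax y hy), by
            rcases le_or_gt (φ y - φ b) 0 with h | h
            · exact mul_nonpos_of_nonneg_of_nonpos ht.1 h
            · exact (mul_le_mul_of_nonneg_right ht.2 h.le).trans (hmax y hy).2⟩⟩
    have s2 : JoinedIn (hoverSet φ a₀ b₀) (a, a, 0) (a, b, 0) :=
      joinedIn_of_forall_mem_Icc (g := fun t => (a, t, 0)) (by fun_prop) hab fun t ht =>
        ⟨ha, ht.1, ht.2.trans hb, by simp, fun y hy => by simpa using hamax y hy⟩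
    exact ⟨a, ⟨ha, hab.trans hb⟩, isMaxOn_iff.2 fun y hy => sub_nonpos.1 (hamax y hy),
      (s2.trans s1).symm⟩
  · have hbmax : IsMaxOn φ (Set.Icc a₀ b₀) b := isMaxOn_iff.2 fun y hy => by
      simpa using (hmax y hy).2
    have hb' : b ∈ Set.Icc a₀ b₀ := ⟨ha.trans hab, hb⟩
    have s1 : JoinedIn (hoverSet φ a₀ b₀) (a, b, 1) (b, b, 1) :=
      joinedIn_of_forall_mem_Icc (g := fun t => (t, b, 1)) (by fun_prop) hab fun t ht =>
        ⟨ha.trans ht.1, ht.2, hb, by simp, fun y hy => by simpa using (hmax y hy).2⟩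
    have s2 : JoinedIn (hoverSet φ a₀ b₀) (b, b, 0) (b, b, 1) :=
      joinedIn_of_forall_mem_Icc (g := fun t => (b, b, t)) (by fun_prop) zero_le_one fun t ht =>
        hover_mem_hoverSet hb' hbmax ht
    exact ⟨b, hb', hbmax, s1.trans s2.symm⟩

theorem isPreconnected_hoverSet (φ : ℝ → ℝ) (a₀ b₀ : ℝ) : IsPreconnected (hoverSet φ a₀ b₀) := by
  have key : ∀ θ ∈ hoverSet φ a₀ b₀, ∀ θ' ∈ hoverSet φ a₀ b₀,
      JoinedIn (hoverSet φ a₀ b₀) θ θ' := by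
    intro θ hθ θ' hθ'
    obtain ⟨c, hc, hm, hj⟩ := exists_joinedIn_hover hθ
    obtain ⟨c', hc', hm', hj'⟩ := exists_joinedIn_hover hθ'
    refine (hj.trans ?_).trans hj'.symm
    rcases le_total c c' with h | h
    · exact joinedIn_hoverSet_of_isMaxOn hc hm hc' hm' h
    · exact (joinedIn_hoverSet_of_isMaxOn hc' hm' hc hm h).symm
  rcases (hoverSet φ a₀ b₀).eq_empty_or_nonempty with h | ⟨θ, hθ⟩
  · rw [h]; exact isPreconnected_empty
  · exact IsConnected.isPreconnected (IsPathConnected.isConnected ⟨θ, hθ, key θ hθ⟩)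

theorem hoverSet_nonempty (hφ : ContinuousOn φ (Set.Icc a₀ b₀)) (h : a₀ ≤ b₀) :
    (hoverSet φ a₀ b₀).Nonempty := by
  obtain ⟨c, hc, hmax⟩ := isCompact_Icc.exists_isMaxOn (Set.nonempty_Icc.2 h) hφ
  exact ⟨(c, c, 0), hover_mem_hoverSet hc hmax (by simp)⟩

end

/-- The hover sets for the weights `w ∈ [0, 1]`, fibered over `w`. -/
def weightedHoverSet (F : ℝ → ℝ → ℝ) (a₀ b₀ : ℝ) : Set (ℝ × ℝ × ℝ × ℝ) :=
  {q | q.1 ∈ Set.Icc (0 : ℝ) 1 ∧ q.2 ∈ hoverSet (F q.1) a₀ b₀}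

section
variable {F : ℝ → ℝ → ℝ} {a₀ b₀ : ℝ}

theorem isCompact_weightedHoverSet
    (hF : ContinuousOn (fun z : ℝ × ℝ => F z.1 z.2) (Set.Icc 0 1 ×ˢ Set.univ)) :
    IsCompact (weightedHoverSet F a₀ b₀) := by
  set B : Set (ℝ × ℝ × ℝ × ℝ) :=
    Set.Icc (0 : ℝ) 1 ×ˢ Set.Icc a₀ b₀ ×ˢ Set.Icc a₀ b₀ ×ˢ Set.Icc (0 : ℝ) 1 with hB
  have hBc : IsCompact B :=
    isCompact_Icc.prod (isCompact_Icc.prod (isCompact_Icc.prod isCompact_Icc))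
  have hFy : ∀ {f : ℝ × ℝ × ℝ × ℝ → ℝ}, Continuous f →
      ContinuousOn (fun q => F q.1 (f q)) B := fun {f} hf =>
    hF.comp (f := fun q : ℝ × ℝ × ℝ × ℝ => (q.1, f q)) (by fun_prop)
      fun q hq => ⟨hq.1, trivial⟩
  have e : weightedHoverSet F a₀ b₀ = (B ∩ {q | q.2.1 ≤ q.2.2.1}) ∩ ⋂ y ∈ Set.Icc a₀ b₀,
      ((B ∩ (fun q => (1 - q.2.2.2) * (F q.1 y - F q.1 q.2.1)) ⁻¹' Set.Iic 0) ∩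
        (B ∩ (fun q => q.2.2.2 * (F q.1 y - F q.1 q.2.2.1)) ⁻¹' Set.Iic 0)) := by
    ext ⟨w, a, b, s⟩
    simp only [weightedHoverSet, hoverSet, hB, Set.mem_ofPred_eq, Set.mem_inter_iff, Set.mem_prod,
      Set.mem_iInter, Set.mem_preimage, Set.mem_Iic, Set.mem_Icc]
    constructor
    · rintro ⟨hw, ha, hab, hb, hs, h⟩
      have : a ≤ b₀ := hab.trans hb
      have : a₀ ≤ b := ha.trans hab
      refine ⟨⟨?_, hab⟩, fun y hy => ⟨⟨?_, (h y hy).1⟩, ?_, (h y hy).2⟩⟩ <;> tauto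
    · rintro ⟨⟨⟨hw, ha, hb, hs⟩, hab⟩, h⟩
      exact ⟨hw, ha.1, hab, hb.2, hs, fun y hy => ⟨(h y hy).1.2, (h y hy).2.2⟩⟩
  rw [e]
  refine (hBc.inter_right (isClosed_le (by fun_prop) (by fun_prop))).inter_right ?_
  refine isClosed_biInter fun y _ => ?_
  have c0 := hFy (f := fun _ => y) continuous_const
  have c1 := hFy (f := fun q => q.2.1) (by fun_prop)
  have c2 := hFy (f := fun q => q.2.2.1) (by fun_prop)
  refine IsClosed.inter ?_ ?_
  · exact ContinuousOn.preimage_isClosed_of_isClosed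
      (ContinuousOn.mul (by fun_prop) (c0.sub c1)) hBc.isClosed isClosed_Iic
  · exact ContinuousOn.preimage_isClosed_of_isClosed
      (ContinuousOn.mul (by fun_prop) (c0.sub c2)) hBc.isClosed isClosed_Iic

theorem exists_mem_weightedHoverSet
    (hF : ContinuousOn (fun z : ℝ × ℝ => F z.1 z.2) (Set.Icc 0 1 ×ˢ Set.univ)) (h : a₀ ≤ b₀)
    {w : ℝ} (hw : w ∈ Set.Icc (0 : ℝ) 1) : ∃ θ, (w, θ) ∈ weightedHoverSet F a₀ b₀ := by
  have : ContinuousOn (F w) (Set.Icc a₀ b₀) :=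
    hF.comp (f := fun y => (w, y)) (by fun_prop) fun y _ => ⟨hw, trivial⟩
  exact (hoverSet_nonempty this h).imp fun θ hθ => ⟨hw, hθ⟩

theorem isPreconnected_weightedHoverSet
    (hF : ContinuousOn (fun z : ℝ × ℝ => F z.1 z.2) (Set.Icc 0 1 ×ˢ Set.univ)) (h : a₀ ≤ b₀) :
    IsPreconnected (weightedHoverSet F a₀ b₀) := by
  refine (isCompact_weightedHoverSet hF).isPreconnected_of_fibers continuous_fst (fun w => ?_) ?_
  · by_cases hw : w ∈ Set.Icc (0 : ℝ) 1
    · convert isPreconnected_singleton.prod (isPreconnected_hoverSet (F w) a₀ b₀) (s := {w}) using 1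
      ext ⟨v, θ⟩
      simp only [weightedHoverSet, Set.mem_inter_iff, Set.mem_ofPred_eq, Set.mem_preimage,
        Set.mem_singleton_iff, Set.mem_prod]
      constructor
      · rintro ⟨h, rfl⟩
        exact ⟨rfl, h.2⟩
      · rintro ⟨rfl, h⟩
        exact ⟨⟨hw, h⟩, rfl⟩
    · convert isPreconnected_empty
      ext ⟨v, θ⟩
      simp only [Set.mem_inter_iff, Set.mem_preimage, Set.mem_singleton_iff,
        Set.mem_empty_iff_false, iff_false, not_and]
      rintro h rfl
      exact hw h.1
  · convert isPreconnected_Icc (a := (0 : ℝ)) (b := 1)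
    ext w
    constructor
    · rintro ⟨q, hq, rfl⟩
      exact hq.1
    · intro hw
      obtain ⟨θ, hθ⟩ := exists_mem_weightedHoverSet hF h hw
      exact ⟨_, hθ, rfl⟩

/-- If the weighted sums of two continuous functions dominate those of a pair `(r₁, r₂)`, then the
functions simultaneously dominate `r₁` and `r₂` at some point. -/
theorem exists_le_and_le_of_weighted_le
    (hF : ContinuousOn (fun z : ℝ × ℝ => F z.1 z.2) (Set.Icc 0 1 ×ˢ Set.univ)) (h : a₀ ≤ b₀)
    {R₁ R₂ : ℝ × ℝ × ℝ × ℝ → ℝ} (hR₁ : ContinuousOn R₁ (weightedHoverSet F a₀ b₀))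
    (hR₂ : ContinuousOn R₂ (weightedHoverSet F a₀ b₀)) {r₁ r₂ : ℝ}
    (hr : ∀ q ∈ weightedHoverSet F a₀ b₀,
      (1 - q.1) * r₁ + q.1 * r₂ ≤ (1 - q.1) * R₁ q + q.1 * R₂ q) :
    ∃ q ∈ weightedHoverSet F a₀ b₀, r₁ ≤ R₁ q ∧ r₂ ≤ R₂ q := by
  have hS := (isCompact_weightedHoverSet (a₀ := a₀) (b₀ := b₀) hF).isClosed
  obtain ⟨θ, hθ⟩ := exists_mem_weightedHoverSet hF h (w := 0) (by simp)
  obtain ⟨θ', hθ'⟩ := exists_mem_weightedHoverSet hF h (w := 1) (by simp)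
  obtain ⟨q, hq, h1, h2⟩ := isPreconnected_closed_iff.1 (isPreconnected_weightedHoverSet hF h) _ _
    (hR₁.preimage_isClosed_of_isClosed hS (isClosed_Ici (a := r₁)))
    (hR₂.preimage_isClosed_of_isClosed hS (isClosed_Ici (a := r₂)))
    (by
      intro q hq
      by_contra hcon
      simp only [Set.mem_union, Set.mem_inter_iff, hq, true_and, Set.mem_preimage, Set.mem_Ici,
        not_or, not_le] at hcon
      have := hr q hq
      have hw := hq.1
      rcases hw.2.lt_or_eq with h1 | h1
      · nlinarith [mul_pos (sub_pos.2 h1) (sub_pos.2 hcon.1),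
          mul_nonneg hw.1 (sub_pos.2 hcon.2).le]
      · rw [h1] at this
        linarith [hcon.2])
    ⟨_, hθ, hθ, by simpa using hr _ hθ⟩ ⟨_, hθ', hθ', by simpa using hr _ hθ'⟩
  exact ⟨q, hq, h1.2, h2.2⟩

end

/-- The increment of a function along a Lipschitz path is at most the integral of a bound on its
derivative along the path, times the Lipschitz constant. -/
theorem comp_sub_comp_le_integral {V s t : ℝ} (hV : 0 < V) (hst : s ≤ t) {x : ℝ → ℝ}
    (hx : ∀ τ τ', |x τ - x τ'| ≤ V * |τ - τ'|) (hxc : Continuous x) {Ψ ψ g : ℝ → ℝ}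
    (hΨ : ∀ y, HasDerivAt Ψ (ψ y) y) (hg : Continuous g)
    (hψ : ∀ τ ∈ Set.Icc s t, |ψ (x τ)| ≤ g (x τ)) :
    Ψ (x t) - Ψ (x s) ≤ V * ∫ τ in s..t, g (x τ) := by
  have hΨc : Continuous Ψ := continuous_iff_continuousAt.2 fun y => (hΨ y).continuousAt
  have hB : ∀ τ, HasDerivAt (fun τ => V * ∫ σ in s..τ, g (x σ)) (V * g (x τ)) τ := fun τ =>
    ((hg.comp hxc).integral_hasStrictDerivAt s τ).hasDerivAt.const_mul V
  refine image_le_of_liminf_slope_right_le_deriv_boundary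
    (f := fun τ => Ψ (x τ) - Ψ (x s)) (B := fun τ => V * ∫ σ in s..τ, g (x σ))
    (B' := fun τ => V * g (x τ)) (by fun_prop) (by simp)
    (fun τ _ => (hB τ).continuousAt.continuousWithinAt) (fun τ _ => (hB τ).hasDerivWithinAt)
    (fun τ hτ r hr => Filter.Eventually.frequently ?_) ⟨hst, le_rfl⟩
  set ε := (r - V * g (x τ)) / (2 * V) with hε
  have hε0 : 0 < ε := div_pos (sub_pos.2 hr) (by linarith)
  have hVε : V * (g (x τ) + ε) < r := by
    have : V * ε = (r - V * g (x τ)) / 2 := by rw [hε]; field_simp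
    nlinarith
  have hev : ∀ᶠ z in nhdsWithin τ (Set.Ioi τ),
      ‖Ψ (x z) - Ψ (x τ) - (x z - x τ) • ψ (x τ)‖ ≤ ε * ‖x z - x τ‖ :=
    ((hasDerivAt_iff_isLittleO.1 (hΨ (x τ))).def hε0 |> hxc.continuousAt.eventually).filter_mono
      nhdsWithin_le_nhds
  filter_upwards [hev, self_mem_nhdsWithin] with z hz hzτ
  have hpos : 0 < z - τ := sub_pos.2 hzτ
  rw [slope_def_field, div_lt_iff₀ hpos, sub_sub_sub_cancel_right]
  rw [Real.norm_eq_abs, Real.norm_eq_abs, smul_eq_mul] at hz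
  have h1 := le_of_abs_le hz
  have h2 : (x z - x τ) * ψ (x τ) ≤ |x z - x τ| * g (x τ) := by
    refine (le_abs_self _).trans ?_
    rw [abs_mul]
    exact mul_le_mul_of_nonneg_left (hψ τ ⟨hτ.1, hτ.2.le⟩) (abs_nonneg _)
  have h3 := hx z τ
  rw [abs_of_pos hpos] at h3
  have h4 : 0 ≤ g (x τ) + ε := by
    linarith [(abs_nonneg _).trans (hψ τ ⟨hτ.1, hτ.2.le⟩)]
  calc Ψ (x z) - Ψ (x τ) ≤ |x z - x τ| * (g (x τ) + ε) := by linarith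
    _ ≤ (V * (z - τ)) * (g (x τ) + ε) := mul_le_mul_of_nonneg_right h3 h4
    _ = V * (g (x τ) + ε) * (z - τ) := by ring
    _ < r * (z - τ) := mul_lt_mul_of_pos_right hVε hpos

/-- A `V`-Lipschitz path covering `[a₀, b₀]` has occupation density at least `1 / V` there. -/
theorem integral_le_mul_integral_comp {V T a₀ b₀ t₁ t₂ : ℝ} (hV : 0 < V) {x g : ℝ → ℝ}
    (hx : ∀ τ τ', |x τ - x τ'| ≤ V * |τ - τ'|) (hxc : Continuous x)
    (hmem : ∀ t ∈ Set.Icc 0 T, x t ∈ Set.Icc a₀ b₀) (ht₁ : t₁ ∈ Set.Icc 0 T)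
    (ht₂ : t₂ ∈ Set.Icc 0 T) (hx₁ : x t₁ = a₀) (hx₂ : x t₂ = b₀) (hg : Continuous g)
    (hg0 : ∀ y ∈ Set.Icc a₀ b₀, 0 ≤ g y) :
    ∫ y in a₀..b₀, g y ≤ V * ∫ t in (0 : ℝ)..T, g (x t) := by
  have hgx : Continuous fun t => g (x t) := hg.comp hxc
  have hmono : ∀ {s t : ℝ}, s ∈ Set.Icc 0 T → t ∈ Set.Icc 0 T → s ≤ t →
      V * ∫ τ in s..t, g (x τ) ≤ V * ∫ t in (0 : ℝ)..T, g (x t) := by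
    intro s t hs ht hst
    refine mul_le_mul_of_nonneg_left (intervalIntegral.integral_mono_interval hs.1 hst ht.2 ?_
      (hgx.intervalIntegrable _ _)) hV.le
    filter_upwards [ae_restrict_mem measurableSet_Ioc] with τ hτ
    exact hg0 _ (hmem τ ⟨hτ.1.le, hτ.2⟩)
  have hΨ : ∀ y, HasDerivAt (fun y => ∫ u in a₀..y, g u) (g y) y := fun y =>
    (hg.integral_hasStrictDerivAt a₀ y).hasDerivAt
  rcases le_total t₁ t₂ with h | h
  · have := comp_sub_comp_le_integral hV h hx hxc hΨ hg fun τ hτ =>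
      (abs_of_nonneg (hg0 _ (hmem τ ⟨ht₁.1.trans hτ.1, hτ.2.trans ht₂.2⟩))).le
    rw [hx₁, hx₂, intervalIntegral.integral_same, sub_zero] at this
    exact this.trans (hmono ht₁ ht₂ h)
  · have := comp_sub_comp_le_integral hV h hx hxc (fun y => (hΨ y).neg) hg fun τ hτ => by
      rw [abs_neg]
      exact (abs_of_nonneg (hg0 _ (hmem τ ⟨ht₂.1.trans hτ.1, hτ.2.trans ht₁.2⟩))).le
    simp only [Pi.neg_apply, hx₁, hx₂, intervalIntegral.integral_same, neg_zero, sub_neg_eq_add,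
      zero_add] at this
    exact this.trans (hmono ht₂ ht₁ h)

/-- The hover-fly-hover trajectory from `a` to `b` spending a fraction `s` of the hovering time at
`b`, where `θ = (a, b, s)`. -/
noncomputable def hoverFly (V T : ℝ) (θ : ℝ × ℝ × ℝ) (t : ℝ) : ℝ :=
  max θ.1 (min θ.2.1 (θ.1 + V * (t - (1 - θ.2.2) * (T - (θ.2.1 - θ.1) / V))))

theorem hfh_eq_hoverFly {V T a b s : ℝ} (hV : 0 < V) (hab : a ≤ b) :
    hfh V T a b ((1 - s) * (T - (b - a) / V)) (s * (T - (b - a) / V)) = hoverFly V T (a, b, s) := by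
  funext t
  unfold hfh hoverFly
  dsimp only
  set E := T - (b - a) / V with hE
  have hVE : V * (T - E) = b - a := by rw [hE]; field_simp; ring
  have hend : V * (T - s * E - (1 - s) * E) = b - a := by rw [← hVE]; ring
  split_ifs with h1 h2
  · have : V * (t - (1 - s) * E) ≤ 0 := mul_nonpos_of_nonneg_of_nonpos hV.le (by linarith)
    rw [max_eq_left ((min_le_right _ _).trans (by linarith))]
  · have h3 : 0 ≤ V * (t - (1 - s) * E) := mul_nonneg hV.le (by linarith)
    have h4 : V * (t - (1 - s) * E) ≤ b - a := by
      rw [← hend]; exact mul_le_mul_of_nonneg_left (by linarith) hV.le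
    rw [min_eq_right (by linarith), max_eq_right (by linarith)]
  · have h4 : b - a ≤ V * (t - (1 - s) * E) := by
      rw [← hend]; exact mul_le_mul_of_nonneg_left (by linarith) hV.le
    rw [min_eq_left (by linarith), max_eq_right hab]

theorem continuous_hoverFly (V T : ℝ) (θ : ℝ × ℝ × ℝ) : Continuous (hoverFly V T θ) := by
  unfold hoverFly
  fun_prop

theorem continuous_hoverFly_param (V T t : ℝ) : Continuous fun θ => hoverFly V T θ t := by
  unfold hoverFly
  fun_prop

theorem integral_comp_hoverFly_le {V T a₀ b₀ : ℝ} (hV : 0 < V) (hT : b₀ - a₀ ≤ V * T)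
    {φ g : ℝ → ℝ} {c : ℝ} (hc : c ∈ Set.Icc a₀ b₀) (hmax : IsMaxOn φ (Set.Icc a₀ b₀) c)
    (hg : Continuous g) (hgφ : ∀ y, g y = φ c - φ y) {θ : ℝ × ℝ × ℝ}
    (hθ : θ ∈ hoverSet φ a₀ b₀) :
    V * ∫ t in (0 : ℝ)..T, g (hoverFly V T θ t) ≤ ∫ y in a₀..b₀, g y := by
  obtain ⟨a, b, s⟩ := θ
  obtain ⟨ha, hab, hb, ⟨hs0, hs1⟩, hθmax⟩ := hθ
  dsimp only at ha hab hb hs0 hs1 hθmax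
  have hg0 : ∀ y ∈ Set.Icc a₀ b₀, 0 ≤ g y := fun y hy => by
    rw [hgφ]; exact sub_nonneg.2 (isMaxOn_iff.1 hmax y hy)
  have hga : (1 - s) * g a = 0 := le_antisymm (by rw [hgφ]; exact (hθmax c hc).1)
    (mul_nonneg (by linarith) (hg0 a ⟨ha, hab.trans hb⟩))
  have hgb : s * g b = 0 := le_antisymm (by rw [hgφ]; exact (hθmax c hc).2)
    (mul_nonneg hs0 (hg0 b ⟨ha.trans hab, hb⟩))
  set E := T - (b - a) / V with hE
  have hE0 : 0 ≤ E := by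
    rw [hE, sub_nonneg, div_le_iff₀ hV]
    nlinarith
  have hVE : V * (T - E) = b - a := by rw [hE]; field_simp; ring
  set tI := (1 - s) * E with htI
  set tF := T - s * E with htF
  have hend : V * (tF - tI) = b - a := by rw [← hVE, htF, htI]; ring
  have htI0 : 0 ≤ tI := mul_nonneg (by linarith) hE0
  have htIF : tI ≤ tF := by
    have : 0 ≤ V * (tF - tI) := by linarith
    linarith [nonneg_of_mul_nonneg_right this hV]
  have htFT : tF ≤ T := by linarith [mul_nonneg hs0 hE0]
  have hc1 : Continuous fun t => g (hoverFly V T (a, b, s) t) :=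
    hg.comp (continuous_hoverFly V T _)
  have hfly : ∀ t, hoverFly V T (a, b, s) t = max a (min b (a + V * (t - tI))) := fun t => rfl
  have i1 : ∫ t in (0 : ℝ)..tI, g (hoverFly V T (a, b, s) t) = 0 := by
    rw [intervalIntegral.integral_congr (g := fun _ => g a), intervalIntegral.integral_const,
      sub_zero, smul_eq_mul, htI, mul_right_comm, hga, zero_mul]
    intro t ht
    rw [Set.uIcc_of_le htI0] at ht
    have : V * (t - tI) ≤ 0 := mul_nonpos_of_nonneg_of_nonpos hV.le (by linarith [ht.2])
    simp only [hfly]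
    rw [max_eq_left ((min_le_right _ _).trans (by linarith))]
  have i3 : ∫ t in tF..T, g (hoverFly V T (a, b, s) t) = 0 := by
    rw [intervalIntegral.integral_congr (g := fun _ => g b), intervalIntegral.integral_const,
      smul_eq_mul, htF, sub_sub_cancel, mul_right_comm, hgb, zero_mul]
    intro t ht
    rw [Set.uIcc_of_le htFT] at ht
    have h4 : b - a ≤ V * (t - tI) := by
      rw [← hend]; exact mul_le_mul_of_nonneg_left (by linarith [ht.1]) hV.le
    simp only [hfly]
    rw [min_eq_left (by linarith), max_eq_right hab]
  have i2 : ∫ t in tI..tF, g (hoverFly V T (a, b, s) t) = V⁻¹ * ∫ y in a..b, g y := by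
    rw [intervalIntegral.integral_congr (g := fun t => g (V * t + (a - V * tI))),
      intervalIntegral.integral_comp_mul_add _ hV.ne', smul_eq_mul, add_sub_cancel,
      show V * tF + (a - V * tI) = b by linarith]
    intro t ht
    rw [Set.uIcc_of_le htIF] at ht
    have h3 : 0 ≤ V * (t - tI) := mul_nonneg hV.le (by linarith [ht.1])
    have h4 : V * (t - tI) ≤ b - a := by
      rw [← hend]; exact mul_le_mul_of_nonneg_left (by linarith [ht.2]) hV.le
    simp only [hfly]
    rw [min_eq_right (by linarith), max_eq_right (by linarith)]
    ring_nf
  rw [← intervalIntegral.integral_add_adjacent_intervals (b := tI)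
      (hc1.intervalIntegrable _ _) (hc1.intervalIntegrable _ _),
    ← intervalIntegral.integral_add_adjacent_intervals (a := tI) (b := tF)
      (hc1.intervalIntegrable _ _) (hc1.intervalIntegrable _ _), i1, i2, i3, zero_add, add_zero,
    mul_inv_cancel_left₀ hV.ne']
  refine intervalIntegral.integral_mono_interval ha hab hb ?_ (hg.intervalIntegrable _ _)
  filter_upwards [ae_restrict_mem measurableSet_Ioc] with y hy
  exact hg0 y ⟨hy.1.le, hy.2⟩

/-- Moving all the excess time of a Lipschitz path to maximizers of `φ` does not decrease the
integral of `φ` along the path. -/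
theorem integral_comp_le_integral_hoverFly {V T a₀ b₀ t₁ t₂ : ℝ} (hV : 0 < V)
    (hT : b₀ - a₀ ≤ V * T) {x φ : ℝ → ℝ} (hx : ∀ τ τ', |x τ - x τ'| ≤ V * |τ - τ'|)
    (hxc : Continuous x) (hmem : ∀ t ∈ Set.Icc 0 T, x t ∈ Set.Icc a₀ b₀)
    (ht₁ : t₁ ∈ Set.Icc 0 T) (ht₂ : t₂ ∈ Set.Icc 0 T) (hx₁ : x t₁ = a₀) (hx₂ : x t₂ = b₀)
    (hφ : Continuous φ) {θ : ℝ × ℝ × ℝ} (hθ : θ ∈ hoverSet φ a₀ b₀) :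
    ∫ t in (0 : ℝ)..T, φ (x t) ≤ ∫ t in (0 : ℝ)..T, φ (hoverFly V T θ t) := by
  obtain ⟨c, hc, hmax⟩ := isCompact_Icc.exists_isMaxOn
    (Set.nonempty_Icc.2 ((hmem t₁ ht₁).1.trans (hmem t₁ ht₁).2)) hφ.continuousOn
  have hg : Continuous fun y => φ c - φ y := by fun_prop
  have e1 := integral_le_mul_integral_comp hV hx hxc hmem ht₁ ht₂ hx₁ hx₂ hg
    fun y hy => sub_nonneg.2 (isMaxOn_iff.1 hmax y hy)
  have e2 := integral_comp_hoverFly_le hV hT hc hmax hg (fun _ => rfl) hθ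
  have e3 := le_of_mul_le_mul_left (e2.trans e1) hV
  have ic : ∀ {y : ℝ → ℝ}, Continuous y → IntervalIntegrable (fun t => φ (y t)) volume 0 T :=
    fun h => (hφ.comp h).intervalIntegrable _ _
  rwa [intervalIntegral.integral_sub intervalIntegrable_const (ic (continuous_hoverFly V T θ)),
    intervalIntegral.integral_sub intervalIntegrable_const (ic hxc), sub_le_sub_iff_left] at e3

section
variable {D H β0 : ℝ}

theorem h1_pos (hH : 0 < H) (hβ : 0 < β0) (x : ℝ) : 0 < h1 D H β0 x := by
  unfold h1; positivity

theorem h2_pos (hH : 0 < H) (hβ : 0 < β0) (x : ℝ) : 0 < h2 D H β0 x := by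
  unfold h2; positivity

theorem h1_le (hH : 0 < H) (hβ : 0 < β0) (x : ℝ) : h1 D H β0 x ≤ β0 / H ^ 2 :=
  div_le_div_of_nonneg_left hβ.le (by positivity) (by linarith [sq_nonneg (x + D / 2)])

theorem h2_le (hH : 0 < H) (hβ : 0 < β0) (x : ℝ) : h2 D H β0 x ≤ β0 / H ^ 2 :=
  div_le_div_of_nonneg_left hβ.le (by positivity) (by linarith [sq_nonneg (x - D / 2)])

theorem continuous_h1 (hH : 0 < H) : Continuous (h1 D H β0) :=
  continuous_const.div (by fun_prop) fun x => by positivity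

theorem continuous_h2 (hH : 0 < H) : Continuous (h2 D H β0) :=
  continuous_const.div (by fun_prop) fun x => by positivity

theorem h1_zero : h1 D H β0 0 = h2 D H β0 0 := by
  unfold h1 h2; ring_nf

theorem h1_ne_h2 (hD : 0 < D) (hH : 0 < H) (hβ : 0 < β0) {x : ℝ} (hx : x ≠ 0) :
    h1 D H β0 x ≠ h2 D H β0 x := by
  unfold h1 h2
  rw [Ne, div_eq_div_iff (by positivity) (by positivity)]
  intro h
  have := mul_left_cancel₀ hβ.ne' h
  exact mul_ne_zero hD.ne' hx (by linarith)

theorem h1_zero_lt (hH : 0 < H) (hβ : 0 < β0) {x : ℝ} (hx : -(D / 2) ≤ x) (hx0 : x < 0) :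
    h1 D H β0 0 < h1 D H β0 x :=
  div_lt_div_of_pos_left hβ (by positivity) (by nlinarith)

theorem h2_zero_lt (hH : 0 < H) (hβ : 0 < β0) {x : ℝ} (hx : x ≤ D / 2) (hx0 : 0 < x) :
    h2 D H β0 0 < h2 D H β0 x :=
  div_lt_div_of_pos_left hβ (by positivity) (by nlinarith)

theorem h1_le_h1_clip (hD : 0 < D) (hH : 0 < H) (hβ : 0 < β0) (x : ℝ) :
    h1 D H β0 x ≤ h1 D H β0 (max (-(D / 2)) (min (D / 2) x)) := by
  refine div_le_div_of_nonneg_left hβ.le (by positivity) (add_le_add_left ?_ _)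
  rcases max_cases (-(D / 2)) (min (D / 2) x) with h | h <;>
    rcases min_cases (D / 2) x with h' | h' <;> rw [h.1] <;> nlinarith

theorem h2_le_h2_clip (hD : 0 < D) (hH : 0 < H) (hβ : 0 < β0) (x : ℝ) :
    h2 D H β0 x ≤ h2 D H β0 (max (-(D / 2)) (min (D / 2) x)) := by
  refine div_le_div_of_nonneg_left hβ.le (by positivity) (add_le_add_left ?_ _)
  rcases max_cases (-(D / 2)) (min (D / 2) x) with h | h <;>
    rcases min_cases (D / 2) x with h' | h' <;> rw [h.1] <;> nlinarith

theorem intervalIntegrable_log_one_add {T M : ℝ} (hT : 0 ≤ T) {u : ℝ → ℝ} (hu : Measurable u)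
    (hu' : ∀ t ∈ Set.Icc 0 T, 0 ≤ u t ∧ u t ≤ M) :
    IntervalIntegrable (fun t => Real.log (1 + u t)) volume 0 T := by
  rw [intervalIntegrable_iff_integrableOn_Ioc_of_le hT]
  refine Measure.integrableOn_of_bounded (M := Real.log (1 + M)) (by simp)
    (Real.measurable_log.comp (hu.const_add 1)).aestronglyMeasurable ?_
  filter_upwards [ae_restrict_mem measurableSet_Ioc] with t ht
  obtain ⟨h0, h1⟩ := hu' t ⟨ht.1.le, ht.2⟩
  rw [Real.norm_of_nonneg (Real.log_nonneg (by linarith))]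
  exact Real.log_le_log (by linarith) (by linarith)

theorem integral_log_one_add_mono {T M : ℝ} (hT : 0 ≤ T) {u v : ℝ → ℝ} (hv : Measurable v)
    (huv : ∀ t ∈ Set.Icc 0 T, 0 ≤ u t ∧ u t ≤ v t ∧ v t ≤ M) :
    ∫ t in (0 : ℝ)..T, Real.log (1 + u t) ≤ ∫ t in (0 : ℝ)..T, Real.log (1 + v t) := by
  have hi := intervalIntegrable_log_one_add hT hv
    fun t ht => ⟨(huv t ht).1.trans (huv t ht).2.1, (huv t ht).2.2⟩
  rw [intervalIntegral.integral_of_le hT, intervalIntegral.integral_of_le hT]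
  rw [intervalIntegrable_iff_integrableOn_Ioc_of_le hT] at hi
  refine integral_mono_of_nonneg ?_ hi ?_
  · filter_upwards [ae_restrict_mem measurableSet_Ioc] with t ht
    exact Real.log_nonneg (by linarith [(huv t ⟨ht.1.le, ht.2⟩).1])
  · filter_upwards [ae_restrict_mem measurableSet_Ioc] with t ht
    obtain ⟨h0, h1, -⟩ := huv t ⟨ht.1.le, ht.2⟩
    exact Real.log_le_log (by linarith) (by linarith)

theorem achievable_iff_log {T : ℝ} (hT : 0 < T) {x p₁ p₂ : ℝ → ℝ} {r₁ r₂ : ℝ} :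
    Achievable D H β0 T x p₁ p₂ r₁ r₂ ↔ 0 ≤ r₁ ∧ 0 ≤ r₂ ∧
      r₁ * (T * Real.log 2) ≤ ∫ t in (0 : ℝ)..T, Real.log (1 + p₁ t * h1 D H β0 (x t)) ∧
      r₂ * (T * Real.log 2) ≤ ∫ t in (0 : ℝ)..T, Real.log (1 + p₂ t * h2 D H β0 (x t)) ∧
      (r₁ + r₂) * (T * Real.log 2) ≤ ∫ t in (0 : ℝ)..T,
        Real.log (1 + (p₁ t * h1 D H β0 (x t) + p₂ t * h2 D H β0 (x t))) := by
  have h2 : 0 < T * Real.log 2 := mul_pos hT (Real.log_pos one_lt_two)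
  have key : ∀ r I : ℝ, r ≤ 1 / T * (I / Real.log 2) ↔ r * (T * Real.log 2) ≤ I := fun r I => by
    rw [div_mul_div_comm, one_mul, le_div_iff₀ h2]
  simp only [Achievable, Real.logb, intervalIntegral.integral_div, key, add_assoc]

theorem FeasiblePower.mul_h1_mem {P T : ℝ} {p₁ p₂ : ℝ → ℝ} (hp : FeasiblePower P T p₁ p₂)
    (hH : 0 < H) (hβ : 0 < β0) (x : ℝ) {t : ℝ} (ht : t ∈ Set.Icc 0 T) :
    0 ≤ p₁ t * h1 D H β0 x ∧ p₁ t * h1 D H β0 x ≤ P * (β0 / H ^ 2) := by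
  obtain ⟨h, h', h''⟩ := hp.2.2 t ht
  exact ⟨mul_nonneg h (h1_pos hH hβ x).le,
    mul_le_mul (by linarith) (h1_le hH hβ x) (h1_pos hH hβ x).le (by linarith)⟩

theorem FeasiblePower.mul_h2_mem {P T : ℝ} {p₁ p₂ : ℝ → ℝ} (hp : FeasiblePower P T p₁ p₂)
    (hH : 0 < H) (hβ : 0 < β0) (x : ℝ) {t : ℝ} (ht : t ∈ Set.Icc 0 T) :
    0 ≤ p₂ t * h2 D H β0 x ∧ p₂ t * h2 D H β0 x ≤ P * (β0 / H ^ 2) := by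
  obtain ⟨h, h', h''⟩ := hp.2.2 t ht
  exact ⟨mul_nonneg h' (h2_pos hH hβ x).le,
    mul_le_mul (by linarith) (h2_le hH hβ x) (h2_pos hH hβ x).le (by linarith)⟩

/-- Increasing the channel gains at all times preserves achievability. -/
theorem Achievable.mono_gain {P T : ℝ} {x y p₁ p₂ : ℝ → ℝ} {r₁ r₂ : ℝ}
    (h : Achievable D H β0 T x p₁ p₂ r₁ r₂) (hH : 0 < H) (hβ : 0 < β0) (hT : 0 < T)
    (hp : FeasiblePower P T p₁ p₂) (hy : Measurable y)
    (hxy₁ : ∀ t ∈ Set.Icc 0 T, h1 D H β0 (x t) ≤ h1 D H β0 (y t))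
    (hxy₂ : ∀ t ∈ Set.Icc 0 T, h2 D H β0 (x t) ≤ h2 D H β0 (y t)) :
    Achievable D H β0 T y p₁ p₂ r₁ r₂ := by
  rw [achievable_iff_log hT] at h ⊢
  obtain ⟨hr₁, hr₂, e₁, e₂, e⟩ := h
  have m₁ : Measurable fun t => p₁ t * h1 D H β0 (y t) :=
    hp.1.mul ((continuous_h1 hH).measurable.comp hy)
  have m₂ : Measurable fun t => p₂ t * h2 D H β0 (y t) :=
    hp.2.1.mul ((continuous_h2 hH).measurable.comp hy)
  have b₁ : ∀ t ∈ Set.Icc 0 T, p₁ t * h1 D H β0 (x t) ≤ p₁ t * h1 D H β0 (y t) := fun t ht =>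
    mul_le_mul_of_nonneg_left (hxy₁ t ht) (hp.2.2 t ht).1
  have b₂ : ∀ t ∈ Set.Icc 0 T, p₂ t * h2 D H β0 (x t) ≤ p₂ t * h2 D H β0 (y t) := fun t ht =>
    mul_le_mul_of_nonneg_left (hxy₂ t ht) (hp.2.2 t ht).2.1
  refine ⟨hr₁, hr₂, e₁.trans (integral_log_one_add_mono hT.le m₁ fun t ht =>
      ⟨(hp.mul_h1_mem hH hβ _ ht).1, b₁ t ht, (hp.mul_h1_mem hH hβ _ ht).2⟩),
    e₂.trans (integral_log_one_add_mono hT.le m₂ fun t ht =>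
      ⟨(hp.mul_h2_mem hH hβ _ ht).1, b₂ t ht, (hp.mul_h2_mem hH hβ _ ht).2⟩),
    e.trans (integral_log_one_add_mono hT.le (m₁.add m₂) fun t ht =>
      ⟨add_nonneg (hp.mul_h1_mem hH hβ _ ht).1 (hp.mul_h2_mem hH hβ _ ht).1,
        add_le_add (b₁ t ht) (b₂ t ht),
        add_le_add (hp.mul_h1_mem hH hβ _ ht).2 (hp.mul_h2_mem hH hβ _ ht).2⟩)⟩

/-- Largest value of `(1 - w) * r₁ + w * r₂` over the instantaneous rate pairs `(r₁, r₂)` that are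
supported, with total power `P`, at the position `x`. -/
noncomputable def maxWeightedRate (D H β0 P w x : ℝ) : ℝ :=
  (1 - w) * optRate₁ P w (h1 D H β0 x) (h2 D H β0 x) +
    w * optRate₂ P w (h1 D H β0 x) (h2 D H β0 x)

theorem continuousOn_maxWeightedRate {P : ℝ} (hH : 0 < H) (hβ : 0 < β0) (hP : 0 < P) :
    ContinuousOn (fun z : ℝ × ℝ => maxWeightedRate D H β0 P z.1 z.2) (Set.Icc 0 1 ×ˢ Set.univ) :=
  continuousOn_weighted_optRate hP (continuous_h1 hH) (continuous_h2 hH) (h1_pos hH hβ)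
    (h2_pos hH hβ)

theorem continuous_maxWeightedRate {P w : ℝ} (hH : 0 < H) (hβ : 0 < β0) (hP : 0 < P)
    (hw : w ∈ Set.Icc (0 : ℝ) 1) : Continuous (maxWeightedRate D H β0 P w) :=
  (continuousOn_maxWeightedRate hH hβ hP).comp_continuous (f := fun x => (w, x)) (by fun_prop)
    fun _ => ⟨hw, trivial⟩

theorem maxWeightedRate_half_zero_lt {P x : ℝ} (hH : 0 < H) (hβ : 0 < β0) (hP : 0 < P)
    (hx : x ∈ Set.Icc (-(D / 2)) (D / 2)) (hx0 : x ≠ 0) :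
    maxWeightedRate D H β0 P (1 / 2) 0 < maxWeightedRate D H β0 P (1 / 2) x := by
  have half : (1 / 2 : ℝ) ∈ Set.Icc (0 : ℝ) 1 := by norm_num
  have e : maxWeightedRate D H β0 P (1 / 2) 0 = 1 / 2 * Real.log (1 + P * h1 D H β0 0) := by
    rw [maxWeightedRate, ← weightedRate_optPower, weightedRate_of_le le_rfl, ← h1_zero]
    ring_nf
  have hg₁ := h1_pos (D := D) hH hβ
  have hg₂ := h2_pos (D := D) hH hβ
  rw [e]
  rcases hx0.lt_or_gt with h | h
  · have h' := weightedRate_le_optRate hP half (hg₁ x) (hg₂ x) hP.le le_rfl (by simp)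
    rw [weightedRate_of_le le_rfl] at h'
    refine lt_of_lt_of_le ?_ h'
    have := Real.log_lt_log (by linarith [mul_pos hP (hg₁ 0)])
      (add_lt_add_right (mul_lt_mul_of_pos_left (h1_zero_lt hH hβ hx.1 h) hP) 1)
    simpa using this
  · have h' := weightedRate_le_optRate hP half (hg₁ x) (hg₂ x) le_rfl hP.le (by simp)
    rw [weightedRate_of_le le_rfl] at h'
    refine lt_of_lt_of_le ?_ h'
    have := Real.log_lt_log (by linarith [mul_pos hP (hg₂ 0)])
      (add_lt_add_right (mul_lt_mul_of_pos_left (h2_zero_lt hH hβ hx.2 h) hP) 1)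
    simpa [h1_zero] using this

/-- Weighted sums of achievable rates are bounded by the integral of the maximal instantaneous
weighted sum rate along the trajectory. -/
theorem Achievable.weighted_le_integral {P T w : ℝ} {x p₁ p₂ : ℝ → ℝ} {r₁ r₂ : ℝ}
    (h : Achievable D H β0 T x p₁ p₂ r₁ r₂) (hH : 0 < H) (hβ : 0 < β0) (hP : 0 < P) (hT : 0 < T)
    (hp : FeasiblePower P T p₁ p₂) (hx : Continuous x) (hw : w ∈ Set.Icc (0 : ℝ) 1) :
    (1 - w) * (r₁ * (T * Real.log 2)) + w * (r₂ * (T * Real.log 2)) ≤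
      ∫ t in (0 : ℝ)..T, maxWeightedRate D H β0 P w (x t) := by
  rw [achievable_iff_log hT] at h
  obtain ⟨-, -, e₁, e₂, e⟩ := h
  have m₁ : Measurable fun t => p₁ t * h1 D H β0 (x t) :=
    hp.1.mul ((continuous_h1 hH).comp hx).measurable
  have m₂ : Measurable fun t => p₂ t * h2 D H β0 (x t) :=
    hp.2.1.mul ((continuous_h2 hH).comp hx).measurable
  have i₁ := intervalIntegrable_log_one_add hT.le m₁ fun t ht => hp.mul_h1_mem hH hβ _ ht
  have i₂ := intervalIntegrable_log_one_add hT.le m₂ fun t ht => hp.mul_h2_mem hH hβ _ ht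
  have i := intervalIntegrable_log_one_add hT.le (m₁.add m₂) fun t ht =>
    ⟨add_nonneg (hp.mul_h1_mem hH hβ (x t) ht).1 (hp.mul_h2_mem hH hβ (x t) ht).1,
      add_le_add (hp.mul_h1_mem hH hβ (x t) ht).2 (hp.mul_h2_mem hH hβ (x t) ht).2⟩
  simp only [Pi.add_apply] at i
  have hint := ((i.const_mul (min w (1 - w))).add (i₁.const_mul (max (1 - 2 * w) 0))).add
    (i₂.const_mul (max (2 * w - 1) 0))
  calc (1 - w) * (r₁ * (T * Real.log 2)) + w * (r₂ * (T * Real.log 2))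
      = min w (1 - w) * ((r₁ + r₂) * (T * Real.log 2)) +
          max (1 - 2 * w) 0 * (r₁ * (T * Real.log 2)) +
          max (2 * w - 1) 0 * (r₂ * (T * Real.log 2)) := by
        rcases le_total w (1 / 2) with h | h
        · rw [min_eq_left (by linarith), max_eq_left (by linarith), max_eq_right (by linarith)]
          ring
        · rw [min_eq_right (by linarith), max_eq_right (by linarith), max_eq_left (by linarith)]
          ring
    _ ≤ _ := add_le_add (add_le_add
          (mul_le_mul_of_nonneg_left e (le_min hw.1 (sub_nonneg.2 hw.2)))
          (mul_le_mul_of_nonneg_left e₁ (le_max_right _ _)))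
          (mul_le_mul_of_nonneg_left e₂ (le_max_right _ _))
    _ = ∫ t in (0 : ℝ)..T, weightedRate w (h1 D H β0 (x t)) (h2 D H β0 (x t)) (p₁ t) (p₂ t) := by
        rw [← intervalIntegral.integral_const_mul, ← intervalIntegral.integral_const_mul,
          ← intervalIntegral.integral_const_mul,
          ← intervalIntegral.integral_add (i.const_mul _) (i₁.const_mul _),
          ← intervalIntegral.integral_add ((i.const_mul _).add (i₁.const_mul _)) (i₂.const_mul _)]
        simp only [weightedRate, add_assoc]
    _ ≤ _ := by
        refine intervalIntegral.integral_mono_on hT.le ?_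
          (((continuous_maxWeightedRate hH hβ hP hw).comp hx).intervalIntegrable _ _)
          fun t ht => weightedRate_le_optRate hP hw (h1_pos hH hβ _) (h2_pos hH hβ _)
            (hp.2.2 t ht).1 (hp.2.2 t ht).2.1 (hp.2.2 t ht).2.2
        simpa only [weightedRate, add_assoc] using hint

end

/-- A hovering trajectory only passes instantaneously through a point that is not a maximizer. -/
theorem hoverFly_ne_zero_of_ne {V T a₀ b₀ t : ℝ} (hV : 0 < V) (hab : a₀ < b₀) {φ : ℝ → ℝ}
    (hφ : ∀ y ∈ Set.Icc a₀ b₀, y ≠ 0 → φ 0 < φ y) {θ : ℝ × ℝ × ℝ} (hθ : θ ∈ hoverSet φ a₀ b₀)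
    (ht0 : 0 < t) (htT : t < T)
    (ht : t ≠ (1 - θ.2.2) * (T - (θ.2.1 - θ.1) / V) - θ.1 / V) : hoverFly V T θ t ≠ 0 := by
  obtain ⟨a, b, s⟩ := θ
  obtain ⟨ha, hab', hb, ⟨hs0, hs1⟩, hmax⟩ := hθ
  dsimp only at ha hab' hb hs0 hs1 hmax ht
  obtain ⟨y, hy, hy0⟩ : ∃ y ∈ Set.Icc a₀ b₀, y ≠ 0 := by
    rcases eq_or_ne a₀ 0 with h | h
    · exact ⟨b₀, ⟨hab.le, le_rfl⟩, by linarith⟩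
    · exact ⟨a₀, ⟨le_rfl, hab.le⟩, h⟩
  have hlt := sub_pos.2 (hφ y hy hy0)
  have ha0 : a = 0 → s = 1 := by
    rintro rfl
    linarith [nonpos_of_mul_nonpos_left (hmax y hy).1 hlt]
  have hb0 : b = 0 → s = 0 := by
    rintro rfl
    exact le_antisymm (nonpos_of_mul_nonpos_left (hmax y hy).2 hlt) hs0
  unfold hoverFly
  dsimp only
  intro h0
  rcases max_cases a (min b (a + V * (t - (1 - s) * (T - (b - a) / V)))) with h | h
  · have := ha0 (by linarith)
    have hVt := mul_pos hV ht0
    subst this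
    rcases min_cases b (a + V * (t - (1 - 1) * (T - (b - a) / V))) with h' | h'
    · exact zero_ne_one (hb0 (by linarith)).symm
    · linarith
  · rcases min_cases b (a + V * (t - (1 - s) * (T - (b - a) / V))) with h' | h'
    · have := hb0 (by linarith)
      subst this
      have e : a + V * (t - (1 - 0) * (T - (b - a) / V)) = b + V * (t - T) := by
        field_simp; ring
      have := mul_pos hV (sub_pos.2 htT)
      linarith
    · apply ht
      have : V * (t - (1 - s) * (T - (b - a) / V)) = -a := by linarith
      field_simp at this ⊢
      linarith

theorem continuousOn_integral_hoverFly {V T a₀ b₀ C : ℝ} (hV : 0 < V) (hT : 0 ≤ T) (hab : a₀ < b₀)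
    {F r : ℝ → ℝ → ℝ} (hF : ∀ y ∈ Set.Icc a₀ b₀, y ≠ 0 → F (1 / 2) 0 < F (1 / 2) y)
    (hr : ∀ w ∈ Set.Icc (0 : ℝ) 1, ∀ x, w ≠ 1 / 2 ∨ x ≠ 0 →
      ContinuousAt (fun z : ℝ × ℝ => r z.1 z.2) (w, x))
    (hrm : ∀ w, Measurable (r w)) (hrb : ∀ w ∈ Set.Icc (0 : ℝ) 1, ∀ x, |r w x| ≤ C) :
    ContinuousOn (fun q : ℝ × ℝ × ℝ × ℝ => ∫ t in (0 : ℝ)..T, r q.1 (hoverFly V T q.2 t))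
      (weightedHoverSet F a₀ b₀) := by
  intro q hq
  refine intervalIntegral.continuousWithinAt_of_dominated_interval (bound := fun _ => C)
    (Filter.Eventually.of_forall fun q' => ?_) ?_ intervalIntegrable_const ?_
  · exact ((hrm _).comp (continuous_hoverFly V T _).measurable).aestronglyMeasurable
  · filter_upwards [self_mem_nhdsWithin] with q' hq'
    exact Filter.Eventually.of_forall fun t _ => hrb _ hq'.1 _
  · have hne : ∀ c : ℝ, ∀ᵐ t : ℝ, t ≠ c := fun c => by simp [ae_iff]
    filter_upwards [hne T,
      hne ((1 - q.2.2.2) * (T - (q.2.2.1 - q.2.1) / V) - q.2.1 / V)] with t htT ht htm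
    rw [Set.uIoc_of_le hT] at htm
    have hgood : q.1 ≠ 1 / 2 ∨ hoverFly V T q.2 t ≠ 0 := by
      refine or_iff_not_imp_left.2 fun hw => ?_
      rw [not_not] at hw
      exact hoverFly_ne_zero_of_ne hV hab hF (hw ▸ hq.2) htm.1 (lt_of_le_of_ne htm.2 htT) ht
    have hc : Continuous fun q : ℝ × ℝ × ℝ × ℝ => (q.1, hoverFly V T q.2 t) :=
      continuous_fst.prodMk ((continuous_hoverFly_param V T t).comp continuous_snd)
    exact (ContinuousAt.comp (f := fun q : ℝ × ℝ × ℝ × ℝ => (q.1, hoverFly V T q.2 t))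
      (hr q.1 hq.1 _ hgood) hc.continuousAt).continuousWithinAt

theorem abs_clip_sub_clip_le (a b u v : ℝ) :
    |max a (min b u) - max a (min b v)| ≤ |u - v| :=
  (abs_max_sub_max_le_max a (min b u) a (min b v)).trans <| by
    rw [sub_self, abs_zero, max_eq_right (abs_nonneg _)]
    refine (abs_min_sub_min_le_max b u b v).trans ?_
    rw [sub_self, abs_zero, max_eq_right (abs_nonneg _)]

theorem clip_eq_self {a b u : ℝ} (hu : u ∈ Set.Icc a b) : max a (min b u) = u := by
  rw [min_eq_right hu.2, max_eq_right hu.1]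

section
variable {D H β0 P V T : ℝ}

theorem abs_optRate₁_le {w : ℝ} (hH : 0 < H) (hβ : 0 < β0) (hP : 0 < P)
    (hw : w ∈ Set.Icc (0 : ℝ) 1) (x : ℝ) :
    |optRate₁ P w (h1 D H β0 x) (h2 D H β0 x)| ≤ Real.log (1 + P * (β0 / H ^ 2)) := by
  rw [abs_of_nonneg (optRate₁_nonneg hP hw (h1_pos hH hβ x) (h2_pos hH hβ x))]
  exact optRate₁_le_const hP hw (h1_pos hH hβ x) (h2_pos hH hβ x) (h1_le hH hβ x)

theorem intervalIntegrable_optRate₁ {w : ℝ} {x : ℝ → ℝ} (hH : 0 < H) (hβ : 0 < β0) (hP : 0 < P)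
    (hT : 0 ≤ T) (hw : w ∈ Set.Icc (0 : ℝ) 1) (hx : Measurable x) :
    IntervalIntegrable (fun t => optRate₁ P w (h1 D H β0 (x t)) (h2 D H β0 (x t))) volume 0 T := by
  rw [intervalIntegrable_iff_integrableOn_Ioc_of_le hT]
  exact Measure.integrableOn_of_bounded (by simp)
    (measurable_optRate₁ P w ((continuous_h1 hH).measurable.comp hx)
      ((continuous_h2 hH).measurable.comp hx)).aestronglyMeasurable
    (Filter.Eventually.of_forall fun t => abs_optRate₁_le hH hβ hP hw (x t))

theorem abs_optRate₂_le {w : ℝ} (hH : 0 < H) (hβ : 0 < β0) (hP : 0 < P)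
    (hw : w ∈ Set.Icc (0 : ℝ) 1) (x : ℝ) :
    |optRate₂ P w (h1 D H β0 x) (h2 D H β0 x)| ≤ Real.log (1 + P * (β0 / H ^ 2)) := by
  rw [abs_of_nonneg (optRate₂_nonneg hP hw (h1_pos hH hβ x) (h2_pos hH hβ x))]
  exact optRate₂_le_const hP hw (h1_pos hH hβ x) (h2_pos hH hβ x) (h2_le hH hβ x)

theorem intervalIntegrable_optRate₂ {w : ℝ} {x : ℝ → ℝ} (hH : 0 < H) (hβ : 0 < β0) (hP : 0 < P)
    (hT : 0 ≤ T) (hw : w ∈ Set.Icc (0 : ℝ) 1) (hx : Measurable x) :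
    IntervalIntegrable (fun t => optRate₂ P w (h1 D H β0 (x t)) (h2 D H β0 (x t))) volume 0 T := by
  rw [intervalIntegrable_iff_integrableOn_Ioc_of_le hT]
  exact Measure.integrableOn_of_bounded (by simp)
    (measurable_optRate₂ P w ((continuous_h1 hH).measurable.comp hx)
      ((continuous_h2 hH).measurable.comp hx)).aestronglyMeasurable
    (Filter.Eventually.of_forall fun t => abs_optRate₂_le hH hβ hP hw (x t))

/-- The rates of the maximal weighted sum rate are achieved by splitting the power optimally. -/
theorem achievable_optPower {w r₁ r₂ : ℝ} {x : ℝ → ℝ} (hH : 0 < H) (hβ : 0 < β0) (hP : 0 < P)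
    (hT : 0 < T) (hw : w ∈ Set.Icc (0 : ℝ) 1) (hx : Measurable x) (hr₁ : 0 ≤ r₁) (hr₂ : 0 ≤ r₂)
    (h₁ : r₁ * (T * Real.log 2) ≤
      ∫ t in (0 : ℝ)..T, optRate₁ P w (h1 D H β0 (x t)) (h2 D H β0 (x t)))
    (h₂ : r₂ * (T * Real.log 2) ≤
      ∫ t in (0 : ℝ)..T, optRate₂ P w (h1 D H β0 (x t)) (h2 D H β0 (x t))) :
    ∃ p₁ p₂, FeasiblePower P T p₁ p₂ ∧ Achievable D H β0 T x p₁ p₂ r₁ r₂ := by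
  have hg₁ := fun t => h1_pos (D := D) hH hβ (x t)
  have hg₂ := fun t => h2_pos (D := D) hH hβ (x t)
  have m₁ : Measurable fun t => h1 D H β0 (x t) := (continuous_h1 hH).measurable.comp hx
  have m₂ : Measurable fun t => h2 D H β0 (x t) := (continuous_h2 hH).measurable.comp hx
  set p : ℝ → ℝ := fun t => optPower P w (h1 D H β0 (x t)) (h2 D H β0 (x t)) with hp
  have hpm : Measurable p := measurable_optPower P w m₁ m₂
  have hpI : ∀ t, p t ∈ Set.Icc 0 P := fun t => optPower_mem_Icc hP hw (hg₁ t) (hg₂ t)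
  have hfeas : FeasiblePower P T p fun t => P - p t :=
    ⟨hpm, hpm.const_sub P, fun t _ => ⟨(hpI t).1, sub_nonneg.2 (hpI t).2, by simp⟩⟩
  have i₁ := intervalIntegrable_optRate₁ (D := D) hH hβ hP hT.le hw hx
  have i₂ := intervalIntegrable_optRate₂ (D := D) hH hβ hP hT.le hw hx
  refine ⟨p, fun t => P - p t, hfeas, (achievable_iff_log hT).2 ⟨hr₁, hr₂, ?_, ?_, ?_⟩⟩
  · exact h₁.trans (intervalIntegral.integral_mono_on hT.le i₁
      (intervalIntegrable_log_one_add hT.le (hpm.mul m₁) fun t ht => hfeas.mul_h1_mem hH hβ _ ht)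
      fun t _ => optRate₁_le hP hw (hg₁ t) (hg₂ t))
  · exact h₂.trans (intervalIntegral.integral_mono_on hT.le i₂
      (intervalIntegrable_log_one_add hT.le ((hpm.const_sub P).mul m₂)
        fun t ht => hfeas.mul_h2_mem hH hβ _ ht)
      fun t _ => optRate₂_le hP hw (hg₁ t) (hg₂ t))
  · rw [add_mul]
    refine (add_le_add h₁ h₂).trans_eq ?_
    rw [← intervalIntegral.integral_add i₁ i₂]
    simp only [optRate_add, hp, add_assoc]

/-- If the range of a trajectory is a nondegenerate interval in `[-D/2, D/2]`, then its achievable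
rates are also achieved by a hover-fly-hover trajectory. -/
theorem Achievable.exists_hoverFly {a₀ b₀ t₁ t₂ r₁ r₂ : ℝ} {x p₁ p₂ : ℝ → ℝ}
    (h : Achievable D H β0 T x p₁ p₂ r₁ r₂) (hD : 0 < D) (hH : 0 < H) (hβ : 0 < β0) (hP : 0 < P)
    (hV : 0 < V) (hT : 0 < T) (hp : FeasiblePower P T p₁ p₂)
    (hx : ∀ s t, |x s - x t| ≤ V * |s - t|) (hxc : Continuous x)
    (hmem : ∀ t ∈ Set.Icc 0 T, x t ∈ Set.Icc a₀ b₀) (ht₁ : t₁ ∈ Set.Icc 0 T)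
    (ht₂ : t₂ ∈ Set.Icc 0 T) (hx₁ : x t₁ = a₀) (hx₂ : x t₂ = b₀) (hab : a₀ < b₀)
    (ha₀ : -(D / 2) ≤ a₀) (hb₀ : b₀ ≤ D / 2) :
    ∃ a b s, a₀ ≤ a ∧ a ≤ b ∧ b ≤ b₀ ∧ s ∈ Set.Icc (0 : ℝ) 1 ∧ b - a ≤ V * T ∧
      ∃ p₁ p₂, FeasiblePower P T p₁ p₂ ∧
        Achievable D H β0 T (hoverFly V T (a, b, s)) p₁ p₂ r₁ r₂ := by
  have hVT : b₀ - a₀ ≤ V * T := by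
    have h1 := (le_abs_self _).trans (hx t₂ t₁)
    rw [hx₁, hx₂] at h1
    refine h1.trans (mul_le_mul_of_nonneg_left (abs_le.2 ⟨?_, ?_⟩) hV.le) <;>
      linarith [ht₁.1, ht₁.2, ht₂.1, ht₂.2]
  have hg₁ := h1_pos (D := D) hH hβ
  have hg₂ := h2_pos (D := D) hH hβ
  have hF := continuousOn_maxWeightedRate (D := D) hH hβ hP
  have hF' : ∀ y ∈ Set.Icc a₀ b₀, y ≠ 0 →
      maxWeightedRate D H β0 P (1 / 2) 0 < maxWeightedRate D H β0 P (1 / 2) y := fun y hy hy0 =>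
    maxWeightedRate_half_zero_lt hH hβ hP ⟨ha₀.trans hy.1, hy.2.trans hb₀⟩ hy0
  have hgc : ∀ z : ℝ × ℝ, ContinuousAt (fun z : ℝ × ℝ => (z.1, h1 D H β0 z.2, h2 D H β0 z.2)) z :=
    fun z => (continuous_fst.prodMk (((continuous_h1 hH).comp continuous_snd).prodMk
      ((continuous_h2 hH).comp continuous_snd))).continuousAt
  have m₁ := (continuous_h1 (D := D) (β0 := β0) hH).measurable
  have m₂ := (continuous_h2 (D := D) (β0 := β0) hH).measurable
  have hR₁ := continuousOn_integral_hoverFly (T := T) hV hT.le hab hF'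
    (r := fun w x => optRate₁ P w (h1 D H β0 x) (h2 D H β0 x))
    (fun w hw x hwx => ContinuousAt.comp
      (f := fun z : ℝ × ℝ => (z.1, h1 D H β0 z.2, h2 D H β0 z.2))
      (continuousAt_optRate₁ hP hw (hg₁ x) (hg₂ x) (hwx.imp_right (h1_ne_h2 hD hH hβ))) (hgc _))
    (fun w => measurable_optRate₁ P w m₁ m₂)
    (fun w hw x => abs_optRate₁_le hH hβ hP hw x)
  have hR₂ := continuousOn_integral_hoverFly (T := T) hV hT.le hab hF'
    (r := fun w x => optRate₂ P w (h1 D H β0 x) (h2 D H β0 x))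
    (fun w hw x hwx => ContinuousAt.comp
      (f := fun z : ℝ × ℝ => (z.1, h1 D H β0 z.2, h2 D H β0 z.2))
      (continuousAt_optRate₂ hP hw (hg₁ x) (hg₂ x) (hwx.imp_right (h1_ne_h2 hD hH hβ))) (hgc _))
    (fun w => measurable_optRate₂ P w m₁ m₂)
    (fun w hw x => abs_optRate₂_le hH hβ hP hw x)
  obtain ⟨⟨w, a, b, s⟩, hq, e₁, e₂⟩ := exists_le_and_le_of_weighted_le hF hab.le hR₁ hR₂
    (r₁ := r₁ * (T * Real.log 2)) (r₂ := r₂ * (T * Real.log 2)) (by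
      rintro ⟨w, θ⟩ ⟨hw, hθ⟩
      dsimp only at hw hθ ⊢
      refine (h.weighted_le_integral hH hβ hP hT hp hxc hw).trans
        ((integral_comp_le_integral_hoverFly hV hVT hx hxc hmem ht₁ ht₂ hx₁ hx₂
          (continuous_maxWeightedRate hH hβ hP hw) hθ).trans_eq ?_)
      have hm := (continuous_hoverFly V T θ).measurable
      have i₁ := intervalIntegrable_optRate₁ (D := D) hH hβ hP hT.le hw hm
      have i₂ := intervalIntegrable_optRate₂ (D := D) hH hβ hP hT.le hw hm
      rw [← intervalIntegral.integral_const_mul, ← intervalIntegral.integral_const_mul]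
      exact intervalIntegral.integral_add (i₁.const_mul _) (i₂.const_mul _))
  obtain ⟨hw, ha, hab', hb, hs, -⟩ := hq
  dsimp only at hw ha hab' hb hs e₁ e₂
  exact ⟨a, b, s, ha, hab', hb, hs, by linarith, achievable_optPower hH hβ hP hT hw
    (continuous_hoverFly V T _).measurable h.1 h.2.1 e₁ e₂⟩

end

/-- For any finite speed `V > 0` and flight duration `T`, the
hover-fly-hover trajectory is optimal: every point of the capacity region is
componentwise dominated by a pair achievable with some HFH trajectory whose
hovering locations lie in `[-D/2, D/2]`. -/
theorem hfh_trajectory_optimal (D H β0 P V T : ℝ)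
    (hD : 0 < D) (hH : 0 < H) (hβ : 0 < β0) (hP : 0 < P) (hV : 0 < V) (hT : 0 < T)
    (r1 r2 : ℝ) (hmem : (r1, r2) ∈ CapacityRegion D H β0 P V T) :
    ∃ xI xF tI tF : ℝ,
      -(D / 2) ≤ xI ∧ xI ≤ xF ∧ xF ≤ D / 2 ∧
      0 ≤ tI ∧ 0 ≤ tF ∧ tI + (xF - xI) / V + tF = T ∧
      ∃ p1 p2 r1' r2',
        FeasiblePower P T p1 p2 ∧ r1 ≤ r1' ∧ r2 ≤ r2' ∧
        Achievable D H β0 T (hfh V T xI xF tI tF) p1 p2 r1' r2' := by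
  obtain ⟨x, p₁, p₂, hx, hp, h⟩ := hmem
  dsimp only at h
  set y : ℝ → ℝ := fun t => max (-(D / 2)) (min (D / 2) (x (max 0 (min T t)))) with hy
  have hclip : ∀ t, max 0 (min T t) ∈ Set.Icc 0 T := fun t =>
    ⟨le_max_left _ _, max_le hT.le (min_le_left _ _)⟩
  have hyx : ∀ t ∈ Set.Icc 0 T, y t = max (-(D / 2)) (min (D / 2) (x t)) := fun t ht => by
    rw [hy]
    dsimp only
    rw [clip_eq_self ht]
  have hyL : ∀ s t, |y s - y t| ≤ V * |s - t| := fun s t =>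
    (abs_clip_sub_clip_le _ _ _ _).trans <| (hx _ (hclip s) _ (hclip t)).trans <|
      mul_le_mul_of_nonneg_left (abs_clip_sub_clip_le _ _ _ _) hV.le
  have hyc : Continuous y :=
    (LipschitzWith.of_dist_le_mul (K := V.toNNReal) fun s t => by
      simpa [Real.dist_eq, hV.le] using hyL s t).continuous
  have h' : Achievable D H β0 T y p₁ p₂ r1 r2 :=
    h.mono_gain hH hβ hT hp hyc.measurable (fun t ht => hyx t ht ▸ h1_le_h1_clip hD hH hβ _)
      fun t ht => hyx t ht ▸ h2_le_h2_clip hD hH hβ _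
  obtain ⟨t₁, ht₁, hmin⟩ := isCompact_Icc.exists_isMinOn (Set.nonempty_Icc.2 hT.le) hyc.continuousOn
  obtain ⟨t₂, ht₂, hmax⟩ := isCompact_Icc.exists_isMaxOn (Set.nonempty_Icc.2 hT.le) hyc.continuousOn
  rw [isMinOn_iff] at hmin
  rw [isMaxOn_iff] at hmax
  have hlow : ∀ t, -(D / 2) ≤ y t := fun t => le_max_left _ _
  have hupp : ∀ t, y t ≤ D / 2 := fun t => max_le (by linarith) (min_le_left _ _)
  rcases (hmin t₂ ht₂).lt_or_eq with hlt | heq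
  · obtain ⟨a, b, s, ha, hab, hb, hs, hbV, q₁, q₂, hq, hach⟩ :=
      h'.exists_hoverFly hD hH hβ hP hV hT hp hyL hyc (fun t ht => ⟨hmin t ht, hmax t ht⟩) ht₁ ht₂
        rfl rfl hlt (hlow _) (hupp _)
    have hE : 0 ≤ T - (b - a) / V := by
      rw [sub_nonneg, div_le_iff₀ hV]
      linarith
    rw [← hfh_eq_hoverFly hV hab] at hach
    exact ⟨a, b, (1 - s) * (T - (b - a) / V), s * (T - (b - a) / V), (hlow t₁).trans ha, hab,
      hb.trans (hupp t₂), mul_nonneg (sub_nonneg.2 hs.2) hE, mul_nonneg hs.1 hE, by ring,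
      q₁, q₂, r1, r2, hq, le_rfl, le_rfl, hach⟩
  · have hc : ∀ t ∈ Set.Icc 0 T, hfh V T (y t₁) (y t₁) T 0 t = y t := fun t ht => by
      rw [hfh, if_pos ht.2]
      exact le_antisymm (hmin t ht) ((hmax t ht).trans_eq heq.symm)
    have hm : Measurable (hfh V T (y t₁) (y t₁) T 0) := by
      have := hfh_eq_hoverFly (T := T) (s := 0) hV (le_refl (y t₁))
      simp only [sub_self, zero_div, sub_zero, one_mul, zero_mul] at this
      rw [this]
      exact (continuous_hoverFly V T _).measurable
    exact ⟨y t₁, y t₁, T, 0, hlow _, le_rfl, hupp _, hT.le, le_rfl, by simp, p₁, p₂, r1, r2, hp,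
      le_rfl, le_rfl, h'.mono_gain hH hβ hT hp hm (fun t ht => (hc t ht).symm ▸ le_rfl)
        fun t ht => (hc t ht).symm ▸ le_rfl⟩
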